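/- arXiv:2102.09108 — 13 statements merged into one kernel-verified Lean document; each statement's English description precedes it below -/
import Mathlib

section
/- Let M be a graded multiplication R-module and K a proper graded R-submodule of M. If K is a graded φ-primary R-submodule of M, then K is a graded φ-2-absorbing primary R-submodule of M. -/
namespace Gr

variable {R : Type*} [CommRing R] {M : Type*} [AddCommGroup M] [Module R M]

/-- `K` is a graded submodule with respect to the set `HM` of homogeneous elements of `M`:
every element of `K` is a sum of homogeneous elements of `K`,
i.e. `K = ⊕_g (K ∩ M_g)`. -/
def IsGradedSubmodule (HM : Set M) (K : Submodule R M) : Prop :=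
  K ≤ Submodule.span R ((K : Set M) ∩ HM)

/-- A graded prime submodule: a proper graded submodule `P` such that for homogeneous
`r : R` and `m : M`, `r • m ∈ P` implies `m ∈ P` or `r ∈ (P :_R M)`. -/
def IsGradedPrime (HR : Set R) (HM : Set M) (P : Submodule R M) : Prop :=
  P ≠ ⊤ ∧ IsGradedSubmodule HM P ∧
    ∀ r ∈ HR, ∀ m ∈ HM, r • m ∈ P → m ∈ P ∨ r ∈ P.colon ⊤

/-- The graded radical `Grad_M(K)`: the intersection of all graded prime submodules
containing `K` (equal to `⊤ = M` if there are none). -/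
def gradedRadical (HR : Set R) (HM : Set M) (K : Submodule R M) : Submodule R M :=
  sInf {P | IsGradedPrime HR HM P ∧ K ≤ P}

/-- `K` is a graded `φ`-prime submodule (for `φ K = φK`): a proper graded submodule such that
for homogeneous `r`, `m` with `r • m ∈ K - φK`, either `m ∈ K` or `r ∈ (K :_R M)`. -/
def IsGradedPhiPrime (HR : Set R) (HM : Set M) (φK : Set M) (K : Submodule R M) : Prop :=
  K ≠ ⊤ ∧ IsGradedSubmodule HM K ∧
    ∀ r ∈ HR, ∀ m ∈ HM, r • m ∈ K → r • m ∉ φK → m ∈ K ∨ r ∈ K.colon ⊤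

/-- `K` is a graded `φ`-2-absorbing submodule (for `φ K = φK`): a proper graded submodule such
that for homogeneous `x`, `y`, `m` with `x • y • m ∈ K - φK`, either `x • m ∈ K` or
`y • m ∈ K` or `x * y ∈ (K :_R M)`. -/
def IsGradedPhiTwoAbsorbing (HR : Set R) (HM : Set M) (φK : Set M) (K : Submodule R M) : Prop :=
  K ≠ ⊤ ∧ IsGradedSubmodule HM K ∧
    ∀ x ∈ HR, ∀ y ∈ HR, ∀ m ∈ HM, x • y • m ∈ K → x • y • m ∉ φK →
      x • m ∈ K ∨ y • m ∈ K ∨ x * y ∈ K.colon ⊤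

/-- `K` is a graded `φ`-2-absorbing primary submodule (for `φ K = φK`): a proper graded
submodule such that for homogeneous `x`, `y`, `m` with `x • y • m ∈ K - φK`, either
`x • m ∈ Grad_M(K)` or `y • m ∈ Grad_M(K)` or `x * y ∈ (K :_R M)`. -/
def IsGradedPhiTwoAbsorbingPrimary (HR : Set R) (HM : Set M) (φK : Set M)
    (K : Submodule R M) : Prop :=
  K ≠ ⊤ ∧ IsGradedSubmodule HM K ∧
    ∀ x ∈ HR, ∀ y ∈ HR, ∀ m ∈ HM, x • y • m ∈ K → x • y • m ∉ φK →
      x • m ∈ gradedRadical HR HM K ∨ y • m ∈ gradedRadical HR HM K ∨ x * y ∈ K.colon ⊤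

end Gr

namespace Gr

/-- The graded radical `Grad(I)` of an ideal `I` of the `G`-graded ring `R` (graded via `𝒜`):
`r ∈ Grad(I)` iff for every `g : G` there is `n > 0` with `(r_g)^n ∈ I`. -/
def gradIdealRadical {G R : Type*} [DecidableEq G] [CommRing R] (𝒜 : G → AddSubgroup R)
    [DirectSum.Decomposition 𝒜] (I : Ideal R) : Set R :=
  {r | ∀ g : G, ∃ n : ℕ, 0 < n ∧ (DirectSum.decompose 𝒜 r g : R) ^ n ∈ I}

end Gr

namespace Gr

variable {R : Type*} [CommRing R] {M : Type*} [AddCommGroup M] [Module R M]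

/-- `M` is a graded multiplication module: every graded submodule `N` of `M` is of the form
`N = I • M` for some graded ideal `I` of `R`. -/
def IsGradedMultiplication (HR : Set R) (HM : Set M) : Prop :=
  ∀ N : Submodule R M, IsGradedSubmodule HM N →
    ∃ I : Ideal R, IsGradedSubmodule HR I ∧ N = I • (⊤ : Submodule R M)

/-- The `n`-th power `K^n` of a submodule of a (graded) multiplication module, computed via
the canonical presentation `K = (K :_R M) • M`, so `K ^ n = (K :_R M) ^ n • M`. -/
def subPow (K : Submodule R M) (n : ℕ) : Submodule R M :=
  (K.colon ⊤) ^ n • (⊤ : Submodule R M)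

end Gr

namespace Gr

/-- `K` is a graded `φ`-primary submodule (for `φ K = φK`): a proper graded submodule such that
for homogeneous `r`, `m` with `r • m ∈ K - φK`, either `m ∈ K` or `r ∈ Grad((K :_R M))`. -/
def IsGradedPhiPrimary {G R M : Type*} [DecidableEq G] [CommRing R] [AddCommGroup M]
    [Module R M] (𝒜 : G → AddSubgroup R) [DirectSum.Decomposition 𝒜]
    (HR : Set R) (HM : Set M) (φK : Set M) (K : Submodule R M) : Prop :=
  K ≠ ⊤ ∧ IsGradedSubmodule HM K ∧
    ∀ r ∈ HR, ∀ m ∈ HM, r • m ∈ K → r • m ∉ φK →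
      m ∈ K ∨ r ∈ gradIdealRadical 𝒜 (K.colon ⊤)

end Gr

/-- If `M` is a graded multiplication module and `K` is a graded `φ`-primary
submodule of `M`, then `K` is a graded `φ`-2-absorbing primary submodule of `M`. -/
theorem graded_phiPrimary_isGraded_phiTwoAbsorbingPrimary_of_multiplication
    {G : Type*} [Group G] [DecidableEq G]
    {R : Type*} [CommRing R] [Nontrivial R]
    {M : Type*} [AddCommGroup M] [Module R M]
    (𝒜 : G → AddSubgroup R) (ℳ : G → AddSubgroup M)
    [DirectSum.Decomposition 𝒜] [DirectSum.Decomposition ℳ]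
    (hone : (1 : R) ∈ 𝒜 1)
    (hmul : ∀ {g h : G} {a b : R}, a ∈ 𝒜 g → b ∈ 𝒜 h → a * b ∈ 𝒜 (g * h))
    (hsmul : ∀ {g h : G} {a : R} {m : M}, a ∈ 𝒜 g → m ∈ ℳ h → a • m ∈ ℳ (g * h))
    (φ : Submodule R M → Set M)
    (hφsub : ∀ N : Submodule R M, Gr.IsGradedSubmodule (⋃ g, (ℳ g : Set M)) N → φ N ⊆ N)
    (hφgr : ∀ N : Submodule R M, Gr.IsGradedSubmodule (⋃ g, (ℳ g : Set M)) N →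
      φ N = ∅ ∨ ∃ P : Submodule R M, Gr.IsGradedSubmodule (⋃ g, (ℳ g : Set M)) P ∧ φ N = ↑P)
    (hmult : Gr.IsGradedMultiplication (⋃ g, (𝒜 g : Set R)) (⋃ g, (ℳ g : Set M)))
    (K : Submodule R M)
    (hK : Gr.IsGradedPhiPrimary 𝒜 (⋃ g, (𝒜 g : Set R)) (⋃ g, (ℳ g : Set M)) (φ K) K) :
    Gr.IsGradedPhiTwoAbsorbingPrimary (⋃ g, (𝒜 g : Set R)) (⋃ g, (ℳ g : Set M)) (φ K) K := by
  obtain ⟨hne, hgr, hp⟩ := hK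
  refine ⟨hne, hgr, ?_⟩
  intro x hx y hy m hm hxy hnot
  obtain ⟨g, hxg⟩ := Set.mem_iUnion.1 hx
  obtain ⟨h, hyh⟩ := Set.mem_iUnion.1 hy
  obtain ⟨k, hmk⟩ := Set.mem_iUnion.1 hm
  have hym : y • m ∈ ⋃ g, (ℳ g : Set M) := Set.mem_iUnion.2 ⟨h * k, hsmul hyh hmk⟩
  rcases hp x hx (y • m) hym hxy hnot with h1 | h1
  · right; left
    exact (Submodule.mem_sInf).2 fun P hP => hP.2 h1
  · left
    refine (Submodule.mem_sInf).2 fun P hP => ?_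
    obtain ⟨⟨_, _, hprime⟩, hKP⟩ := hP
    obtain ⟨n, hpos, hn⟩ := h1 g
    rw [DirectSum.decompose_of_mem_same 𝒜 hxg] at hn
    have hnm : x ^ n • m ∈ P := hKP (Submodule.mem_colon.1 hn m trivial)
    have hpow : ∀ j : ℕ, x ^ j • m ∈ ⋃ g, (ℳ g : Set M) := by
      intro j
      induction j with
      | zero => simpa using hm
      | succ j ih =>
        obtain ⟨l, hl⟩ := Set.mem_iUnion.1 ih
        rw [pow_succ', mul_smul]
        exact Set.mem_iUnion.2 ⟨g * l, hsmul hxg hl⟩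
    clear hn hpos
    induction n with
    | zero => exact P.smul_mem x (by simpa using hnm)
    | succ j ih =>
      rw [pow_succ', mul_smul] at hnm
      rcases hprime x hx _ (hpow j) hnm with h2 | h2
      · exact ih h2
      · exact Submodule.mem_colon.1 h2 m trivial
end

section
/- Let K be a proper graded R-submodule of M with φ(K) ≠ ∅. Then K is a graded φ-2-absorbing R-submodule of M if and only if K/φ(K) is a graded weakly 2-absorbing R-submodule of the graded quotient module M/φ(K). -/
/-- Let `K` be a proper graded submodule of `M` with `φ(K) ≠ ∅`, say
`φ(K) = P` for a graded submodule `P` of `M`. Then `K` is a graded `φ`-2-absorbing submodule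
of `M` if and only if `K/φ(K)` is a graded weakly 2-absorbing submodule of `M/φ(K)`
(weakly 2-absorbing = `φ₀`-2-absorbing with `φ₀ = {0}`), where `M/φ(K)` is graded by
`(M/φ(K))_g = (M_g + φ(K))/φ(K)`. -/
theorem graded_phiTwoAbsorbing_iff_quotient_weaklyTwoAbsorbing
    {G : Type*} [Group G] [DecidableEq G]
    {R : Type*} [CommRing R] [Nontrivial R]
    {M : Type*} [AddCommGroup M] [Module R M]
    (𝒜 : G → AddSubgroup R) (ℳ : G → AddSubgroup M)
    [DirectSum.Decomposition 𝒜] [DirectSum.Decomposition ℳ]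
    (hone : (1 : R) ∈ 𝒜 1)
    (hmul : ∀ {g h : G} {a b : R}, a ∈ 𝒜 g → b ∈ 𝒜 h → a * b ∈ 𝒜 (g * h))
    (hsmul : ∀ {g h : G} {a : R} {m : M}, a ∈ 𝒜 g → m ∈ ℳ h → a • m ∈ ℳ (g * h))
    (φ : Submodule R M → Set M)
    (hφsub : ∀ N : Submodule R M, Gr.IsGradedSubmodule (⋃ g, (ℳ g : Set M)) N → φ N ⊆ N)
    (hφgr : ∀ N : Submodule R M, Gr.IsGradedSubmodule (⋃ g, (ℳ g : Set M)) N →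
      φ N = ∅ ∨ ∃ P : Submodule R M, Gr.IsGradedSubmodule (⋃ g, (ℳ g : Set M)) P ∧ φ N = ↑P)
    (K : Submodule R M) (hKproper : K ≠ ⊤)
    (hKgraded : Gr.IsGradedSubmodule (⋃ g, (ℳ g : Set M)) K)
    (P : Submodule R M) (hPgraded : Gr.IsGradedSubmodule (⋃ g, (ℳ g : Set M)) P)
    (hφK : φ K = ↑P)
    :
    Gr.IsGradedPhiTwoAbsorbing (⋃ g, (𝒜 g : Set R)) (⋃ g, (ℳ g : Set M)) (φ K) K ↔
      Gr.IsGradedPhiTwoAbsorbing (⋃ g, (𝒜 g : Set R)) (⋃ g, ⇑P.mkQ '' (ℳ g : Set M))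
        ({(0 : M ⧸ P)} : Set (M ⧸ P)) (K.map P.mkQ) := by
  have hPK : P ≤ K := by
    intro z hz
    have h := hφsub K hKgraded
    rw [hφK] at h
    exact h hz
  have hmem : ∀ z : M, P.mkQ z ∈ K.map P.mkQ ↔ z ∈ K := by
    intro z
    constructor
    · rintro ⟨k, hk, hkz⟩
      have h1 : k - z ∈ P := (Submodule.Quotient.eq P).1 hkz
      have h2 := K.sub_mem hk (hPK h1)
      rwa [sub_sub_cancel] at h2
    · intro hz
      exact ⟨z, hz, rfl⟩
  have hcol : ∀ r : R, r ∈ (K.map P.mkQ).colon ⊤ ↔ r ∈ K.colon ⊤ := by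
    intro r
    rw [Submodule.mem_colon, Submodule.mem_colon]
    constructor
    · intro h m _
      have h1 := h (P.mkQ m) trivial
      rw [← map_smul] at h1
      exact (hmem _).1 h1
    · intro h q _
      obtain ⟨m, rfl⟩ := P.mkQ_surjective q
      rw [← map_smul]
      exact (hmem _).2 (h m trivial)
  have hzero : ∀ z : M, P.mkQ z ∈ ({(0 : M ⧸ P)} : Set (M ⧸ P)) ↔ z ∈ φ K := by
    intro z
    rw [hφK]
    exact Submodule.Quotient.mk_eq_zero P
  constructor
  · rintro ⟨_, _, h⟩
    refine ⟨?_, ?_, ?_⟩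
    · intro htop
      apply hKproper
      rw [eq_top_iff]
      intro z _
      rw [← hmem, htop]
      trivial
    · unfold Gr.IsGradedSubmodule at hKgraded ⊢
      refine (Submodule.map_mono hKgraded).trans ?_
      rw [Submodule.map_span]
      apply Submodule.span_mono
      rintro _ ⟨m, ⟨hmK, hm⟩, rfl⟩
      obtain ⟨g, hg⟩ := Set.mem_iUnion.1 hm
      exact ⟨(hmem m).2 hmK, Set.mem_iUnion.2 ⟨g, m, hg, rfl⟩⟩
    · intro x hx y hy q hq h1 h2
      obtain ⟨g, m, hm, rfl⟩ := Set.mem_iUnion.1 hq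
      simp only [← map_smul] at h1 h2 ⊢
      rw [hmem] at h1
      rw [hzero] at h2
      rw [hmem, hmem, hcol]
      exact h x hx y hy m (Set.mem_iUnion.2 ⟨g, hm⟩) h1 h2
  · rintro ⟨_, _, h⟩
    refine ⟨hKproper, hKgraded, ?_⟩
    intro x hx y hy m hm h1 h2
    obtain ⟨g, hg⟩ := Set.mem_iUnion.1 hm
    have h3 := h x hx y hy (P.mkQ m) (Set.mem_iUnion.2 ⟨g, m, hg, rfl⟩)
    simp only [← map_smul] at h3
    rw [hmem, hzero, hmem, hmem, hcol] at h3
    exact h3 h1 h2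
end

section
/- Let K be a proper graded R-submodule of M with φ(K) ≠ ∅. Then K is a graded φ-2-absorbing primary R-submodule of M if and only if K/φ(K) is a graded weakly 2-absorbing primary R-submodule of the graded quotient module M/φ(K). -/
namespace Gr

section aux
variable {R : Type*} [CommRing R] {M : Type*} [AddCommGroup M] [Module R M]

theorem aux_mem_map (P Q : Submodule R M) (h : P ≤ Q) (x : M) :
    P.mkQ x ∈ Q.map P.mkQ ↔ x ∈ Q := by
  constructor
  · rintro ⟨y, hy, hxy⟩
    have h1 : y - x ∈ P := by
      rw [← Submodule.Quotient.eq]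
      exact hxy
    have := Q.sub_mem hy (h h1)
    simpa using this
  · intro hx
    exact Submodule.mem_map_of_mem hx

theorem aux_top (P Q : Submodule R M) (h : P ≤ Q) : Q.map P.mkQ ≠ ⊤ ↔ Q ≠ ⊤ := by
  refine not_congr ?_
  constructor
  · intro e
    rw [eq_top_iff]
    intro x _
    rw [← aux_mem_map P Q h x, e]
    trivial
  · rintro rfl
    simp

theorem aux_colon (P Q : Submodule R M) (h : P ≤ Q) (r : R) :
    r ∈ (Q.map P.mkQ).colon ⊤ ↔ r ∈ Q.colon ⊤ := by
  rw [Submodule.mem_colon, Submodule.mem_colon]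
  constructor
  · intro H x _
    rw [← aux_mem_map P Q h, map_smul]
    exact H _ trivial
  · intro H x _
    obtain ⟨x, rfl⟩ := P.mkQ_surjective x
    rw [← map_smul, aux_mem_map P Q h]
    exact H _ trivial

theorem aux_graded (HM : Set M) (P Q : Submodule R M) (h : P ≤ Q)
    (hP : IsGradedSubmodule HM P) :
    IsGradedSubmodule (P.mkQ '' HM) (Q.map P.mkQ) ↔ IsGradedSubmodule HM Q := by
  have key : ((Q.map P.mkQ : Submodule R (M ⧸ P)) : Set (M ⧸ P)) ∩ (P.mkQ '' HM)
      = P.mkQ '' ((Q : Set M) ∩ HM) := by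
    ext z
    constructor
    · rintro ⟨hz, x, hx, rfl⟩
      exact ⟨x, ⟨(aux_mem_map P Q h x).1 hz, hx⟩, rfl⟩
    · rintro ⟨x, ⟨hx, hx'⟩, rfl⟩
      exact ⟨(aux_mem_map P Q h x).2 hx, x, hx', rfl⟩
  have hPs : P ≤ Submodule.span R ((Q : Set M) ∩ HM) :=
    le_trans hP (Submodule.span_mono (Set.inter_subset_inter_left _ h))
  unfold IsGradedSubmodule
  rw [key, ← Submodule.map_span]
  constructor
  · intro H x hx
    rw [← aux_mem_map P _ hPs]
    exact H ((aux_mem_map P Q h x).2 hx)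
  · intro H
    exact Submodule.map_mono H

theorem aux_prime (HR : Set R) (HM : Set M) (P Q : Submodule R M) (h : P ≤ Q)
    (hP : IsGradedSubmodule HM P) :
    IsGradedPrime HR (P.mkQ '' HM) (Q.map P.mkQ) ↔ IsGradedPrime HR HM Q := by
  unfold IsGradedPrime
  rw [aux_top P Q h, aux_graded HM P Q h hP]
  simp only [Set.forall_mem_image, ← map_smul, aux_mem_map P Q h, aux_colon P Q h]

theorem aux_rad (HR : Set R) (HM : Set M) (P K : Submodule R M) (h : P ≤ K)
    (hP : IsGradedSubmodule HM P) (x : M) :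
    P.mkQ x ∈ gradedRadical HR (P.mkQ '' HM) (K.map P.mkQ) ↔ x ∈ gradedRadical HR HM K := by
  unfold gradedRadical
  simp only [Submodule.mem_sInf, Set.mem_setOf_eq]
  constructor
  · rintro H Q ⟨hQ, hKQ⟩
    have hPQ := h.trans hKQ
    rw [← aux_mem_map P Q hPQ]
    exact H _ ⟨(aux_prime HR HM P Q hPQ hP).2 hQ, Submodule.map_mono hKQ⟩
  · rintro H Q' ⟨hQ, hKQ⟩
    have hPQ : P ≤ Q'.comap P.mkQ := Submodule.le_comap_mkQ P Q'
    have e : (Q'.comap P.mkQ).map P.mkQ = Q' :=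
      Submodule.map_comap_eq_of_surjective P.mkQ_surjective Q'
    refine H (Q'.comap P.mkQ) ⟨?_, Submodule.map_le_iff_le_comap.1 hKQ⟩
    rw [← aux_prime HR HM P _ hPQ hP, e]
    exact hQ

theorem aux_main (HR : Set R) (HM : Set M) (P K : Submodule R M) (h : P ≤ K)
    (hP : IsGradedSubmodule HM P) :
    IsGradedPhiTwoAbsorbingPrimary HR HM (P : Set M) K ↔
      IsGradedPhiTwoAbsorbingPrimary HR (P.mkQ '' HM) ({(0 : M ⧸ P)} : Set (M ⧸ P))
        (K.map P.mkQ) := by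
  have hz : ∀ x : M, P.mkQ x = 0 ↔ x ∈ P := fun x => Submodule.Quotient.mk_eq_zero P
  unfold IsGradedPhiTwoAbsorbingPrimary
  rw [aux_top P K h, aux_graded HM P K h hP]
  simp only [Set.forall_mem_image, ← map_smul, aux_mem_map P K h, aux_colon P K h,
    aux_rad HR HM P K h hP, Set.mem_singleton_iff, hz, SetLike.mem_coe]

end aux

end Gr

/-- Let `K` be a proper graded submodule of `M` with `φ(K) ≠ ∅`, say
`φ(K) = P` for a graded submodule `P` of `M`. Then `K` is a graded `φ`-2-absorbing primary
submodule of `M` if and only if `K/φ(K)` is a graded weakly 2-absorbing primary submodule of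
`M/φ(K)` (weakly 2-absorbing primary = `φ₀`-2-absorbing primary with `φ₀ = {0}`), where
`M/φ(K)` is graded by `(M/φ(K))_g = (M_g + φ(K))/φ(K)`. -/
theorem graded_phiTwoAbsorbingPrimary_iff_quotient_weaklyTwoAbsorbingPrimary
    {G : Type*} [Group G] [DecidableEq G]
    {R : Type*} [CommRing R] [Nontrivial R]
    {M : Type*} [AddCommGroup M] [Module R M]
    (𝒜 : G → AddSubgroup R) (ℳ : G → AddSubgroup M)
    [DirectSum.Decomposition 𝒜] [DirectSum.Decomposition ℳ]
    (hone : (1 : R) ∈ 𝒜 1)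
    (hmul : ∀ {g h : G} {a b : R}, a ∈ 𝒜 g → b ∈ 𝒜 h → a * b ∈ 𝒜 (g * h))
    (hsmul : ∀ {g h : G} {a : R} {m : M}, a ∈ 𝒜 g → m ∈ ℳ h → a • m ∈ ℳ (g * h))
    (φ : Submodule R M → Set M)
    (hφsub : ∀ N : Submodule R M, Gr.IsGradedSubmodule (⋃ g, (ℳ g : Set M)) N → φ N ⊆ N)
    (hφgr : ∀ N : Submodule R M, Gr.IsGradedSubmodule (⋃ g, (ℳ g : Set M)) N →
      φ N = ∅ ∨ ∃ P : Submodule R M, Gr.IsGradedSubmodule (⋃ g, (ℳ g : Set M)) P ∧ φ N = ↑P)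
    (K : Submodule R M) (hKproper : K ≠ ⊤)
    (hKgraded : Gr.IsGradedSubmodule (⋃ g, (ℳ g : Set M)) K)
    (P : Submodule R M) (hPgraded : Gr.IsGradedSubmodule (⋃ g, (ℳ g : Set M)) P)
    (hφK : φ K = ↑P)
    :
    Gr.IsGradedPhiTwoAbsorbingPrimary (⋃ g, (𝒜 g : Set R)) (⋃ g, (ℳ g : Set M)) (φ K) K ↔
      Gr.IsGradedPhiTwoAbsorbingPrimary (⋃ g, (𝒜 g : Set R)) (⋃ g, ⇑P.mkQ '' (ℳ g : Set M))
        ({(0 : M ⧸ P)} : Set (M ⧸ P)) (K.map P.mkQ) := by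
  have hPK : P ≤ K := by
    have := hφsub K hKgraded
    rw [hφK] at this
    exact this
  rw [hφK, ← Set.image_iUnion]
  exact Gr.aux_main _ _ P K hPK hPgraded
end

section
/- Let f : M → L be a graded R-epimorphism of graded R-modules, φ : GS(M) → GS(M) ∪ {∅} and ψ : GS(L) → GS(L) ∪ {∅} functions. If N is a graded ψ-2-absorbing primary R-submodule of L and φ(f⁻¹(N)) = f⁻¹(ψ(N)), then f⁻¹(N) is a graded φ-2-absorbing primary R-submodule of M. -/
namespace GrAux

theorem map_decompose {G M L : Type*} [DecidableEq G] [AddCommGroup M] [AddCommGroup L]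
    (ℳ : G → AddSubgroup M) (𝒩 : G → AddSubgroup L)
    [DirectSum.Decomposition ℳ] [DirectSum.Decomposition 𝒩]
    (f : M →+ L) (hf : ∀ g : G, ∀ m ∈ ℳ g, f m ∈ 𝒩 g) (m : M) (g : G) :
    f (DirectSum.decompose ℳ m g : M) = (DirectSum.decompose 𝒩 (f m) g : L) := by
  induction m using DirectSum.Decomposition.inductionOn ℳ with
  | zero => simp
  | @homogeneous i m =>
    by_cases h : i = g
    · subst h
      rw [DirectSum.decompose_of_mem_same ℳ m.2,
        DirectSum.decompose_of_mem_same 𝒩 (hf _ _ m.2)]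
    · rw [DirectSum.decompose_of_mem_ne ℳ m.2 h,
        DirectSum.decompose_of_mem_ne 𝒩 (hf _ _ m.2) h, map_zero]
  | add a b ha hb =>
    simp only [DirectSum.decompose_add, DirectSum.add_apply, AddSubgroup.coe_add, map_add, ha, hb]

end GrAux

/-- Let `f : M → L` be a graded `R`-epimorphism. If `N` is a graded
`ψ`-2-absorbing primary submodule of `L` and `φ(f⁻¹(N)) = f⁻¹(ψ(N))`, then `f⁻¹(N)` is a
graded `φ`-2-absorbing primary submodule of `M`. -/
theorem comap_graded_phiTwoAbsorbingPrimary
    {G : Type*} [Group G] [DecidableEq G]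
    {R : Type*} [CommRing R] [Nontrivial R]
    {M : Type*} [AddCommGroup M] [Module R M]
    {L : Type*} [AddCommGroup L] [Module R L]
    (𝒜 : G → AddSubgroup R) (ℳ : G → AddSubgroup M) (𝒩 : G → AddSubgroup L)
    [DirectSum.Decomposition 𝒜] [DirectSum.Decomposition ℳ] [DirectSum.Decomposition 𝒩]
    (hone : (1 : R) ∈ 𝒜 1)
    (hmul : ∀ {g h : G} {a b : R}, a ∈ 𝒜 g → b ∈ 𝒜 h → a * b ∈ 𝒜 (g * h))
    (hsmulM : ∀ {g h : G} {a : R} {m : M}, a ∈ 𝒜 g → m ∈ ℳ h → a • m ∈ ℳ (g * h))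
    (hsmulL : ∀ {g h : G} {a : R} {x : L}, a ∈ 𝒜 g → x ∈ 𝒩 h → a • x ∈ 𝒩 (g * h))
    (φ : Submodule R M → Set M)
    (hφsub : ∀ N : Submodule R M, Gr.IsGradedSubmodule (⋃ g, (ℳ g : Set M)) N → φ N ⊆ N)
    (hφgr : ∀ N : Submodule R M, Gr.IsGradedSubmodule (⋃ g, (ℳ g : Set M)) N →
      φ N = ∅ ∨ ∃ P : Submodule R M, Gr.IsGradedSubmodule (⋃ g, (ℳ g : Set M)) P ∧ φ N = ↑P)
    (ψ : Submodule R L → Set L)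
    (hψsub : ∀ N : Submodule R L, Gr.IsGradedSubmodule (⋃ g, (𝒩 g : Set L)) N → ψ N ⊆ N)
    (hψgr : ∀ N : Submodule R L, Gr.IsGradedSubmodule (⋃ g, (𝒩 g : Set L)) N →
      ψ N = ∅ ∨ ∃ P : Submodule R L, Gr.IsGradedSubmodule (⋃ g, (𝒩 g : Set L)) P ∧ ψ N = ↑P)
    (f : M →ₗ[R] L) (hfgraded : ∀ g : G, ∀ m ∈ ℳ g, f m ∈ 𝒩 g)
    (hfsurj : Function.Surjective f)
    (N : Submodule R L)
    (hN : Gr.IsGradedPhiTwoAbsorbingPrimary (⋃ g, (𝒜 g : Set R)) (⋃ g, (𝒩 g : Set L)) (ψ N) N)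
    (hcomp : φ (N.comap f) = ⇑f ⁻¹' (ψ N)) :
    Gr.IsGradedPhiTwoAbsorbingPrimary (⋃ g, (𝒜 g : Set R)) (⋃ g, (ℳ g : Set M)) (φ (N.comap f)) (N.comap f) := by
  have hdec : ∀ m g, f (DirectSum.decompose ℳ m g : M) = (DirectSum.decompose 𝒩 (f m) g : L) :=
    GrAux.map_decompose ℳ 𝒩 f.toAddMonoidHom hfgraded
  have hhom : ∀ m ∈ (⋃ g, (ℳ g : Set M)), f m ∈ (⋃ g, (𝒩 g : Set L)) := by
    intro m hm
    obtain ⟨g, hg⟩ := Set.mem_iUnion.1 hm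
    exact Set.mem_iUnion.2 ⟨g, hfgraded g m hg⟩
  have hlift : ∀ y ∈ (⋃ g, (𝒩 g : Set L)), ∃ m ∈ (⋃ g, (ℳ g : Set M)), f m = y := by
    intro y hy
    obtain ⟨g, hg⟩ := Set.mem_iUnion.1 hy
    obtain ⟨m, rfl⟩ := hfsurj y
    refine ⟨DirectSum.decompose ℳ m g, Set.mem_iUnion.2 ⟨g, SetLike.coe_mem _⟩, ?_⟩
    rw [hdec, DirectSum.decompose_of_mem_same 𝒩 hg]
  have hrad : ∀ m, f m ∈ Gr.gradedRadical (⋃ g, (𝒜 g : Set R)) (⋃ g, (𝒩 g : Set L)) N →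
      m ∈ Gr.gradedRadical (⋃ g, (𝒜 g : Set R)) (⋃ g, (ℳ g : Set M)) (N.comap f) := by
    intro m hm
    refine Submodule.mem_sInf.2 ?_
    rintro P ⟨⟨hP1, hP2, hP3⟩, hNP⟩
    have hback : ∀ x, f x ∈ P.map f → x ∈ P := by
      rintro x ⟨p, hp, hpx⟩
      have h1 : x - p ∈ P := hNP (by simp [hpx])
      simpa using P.add_mem h1 hp
    refine hback m (Submodule.mem_sInf.1 hm (P.map f) ⟨⟨?_, ?_, ?_⟩, ?_⟩)
    · intro h
      exact hP1 (eq_top_iff.2 fun x _ => hback x (h ▸ Submodule.mem_top))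
    · refine (Submodule.map_mono hP2).trans ?_
      rw [Submodule.map_span]
      refine Submodule.span_mono ?_
      rintro _ ⟨x, ⟨hx, hx'⟩, rfl⟩
      exact ⟨⟨x, hx, rfl⟩, hhom x hx'⟩
    · intro r hr y hy hry
      obtain ⟨x, hx, rfl⟩ := hlift y hy
      rw [← map_smul] at hry
      rcases hP3 r hr x hx (hback _ hry) with h | h
      · exact Or.inl ⟨x, h, rfl⟩
      · right
        rw [Submodule.mem_colon] at h ⊢
        intro z _
        obtain ⟨w, rfl⟩ := hfsurj z
        exact ⟨r • w, h w trivial, map_smul f r w⟩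
    · intro y hy
      obtain ⟨x, rfl⟩ := hfsurj y
      exact ⟨x, hNP hy, rfl⟩
  obtain ⟨h1, h2, h3⟩ := hN
  refine ⟨?_, ?_, ?_⟩
  · intro h
    refine h1 (eq_top_iff.2 fun y _ => ?_)
    obtain ⟨x, rfl⟩ := hfsurj y
    have : x ∈ N.comap f := h ▸ Submodule.mem_top
    exact this
  · intro m hm
    have h4 : f m ∈ (Submodule.span R ((N.comap f : Set M) ∩ ⋃ g, (ℳ g : Set M))).map f := by
      rw [Submodule.map_span]
      refine Submodule.span_mono ?_ (h2 hm)
      rintro y ⟨hy, hy'⟩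
      obtain ⟨x, hx, rfl⟩ := hlift y hy'
      exact ⟨x, ⟨hy, hx⟩, rfl⟩
    obtain ⟨s, hs, hsm⟩ := h4
    have hk : f (m - s) = 0 := by simp [hsm]
    have h5 : m - s ∈ Submodule.span R ((N.comap f : Set M) ∩ ⋃ g, (ℳ g : Set M)) := by
      classical
      rw [← DirectSum.sum_support_decompose ℳ (m - s)]
      refine Submodule.sum_mem _ fun g _ => Submodule.subset_span ⟨?_, ?_⟩
      · change f _ ∈ N
        rw [hdec, hk]
        simp
      · exact Set.mem_iUnion.2 ⟨g, SetLike.coe_mem _⟩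
    simpa using Submodule.add_mem _ h5 hs
  · intro x hx y hy m hm hxy hn
    rw [hcomp] at hn
    have e : f (x • y • m) = x • y • f m := by simp
    rcases h3 x hx y hy (f m) (hhom m hm) (e ▸ hxy) (fun h => hn (by
      rw [Set.mem_preimage, e]; exact h)) with h | h | h
    · exact Or.inl (hrad _ (by rwa [map_smul]))
    · exact Or.inr (Or.inl (hrad _ (by rwa [map_smul])))
    · right; right
      rw [Submodule.mem_colon] at h ⊢
      intro z _
      rw [Submodule.mem_comap, map_smul]
      exact h _ trivial
end

section
/- Let f : M → L be a graded R-epimorphism of graded R-modules, φ : GS(M) → GS(M) ∪ {∅} and ψ : GS(L) → GS(L) ∪ {∅} functions. If K is a graded φ-2-absorbing primary R-submodule of M containing Ker(f) and ψ(f(K)) = f(φ(K)), then f(K) is a graded ψ-2-absorbing primary R-submodule of L. -/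
theorem Gr.homog_lift {G : Type*} [DecidableEq G]
    {R : Type*} [CommRing R]
    {M : Type*} [AddCommGroup M] [Module R M]
    {L : Type*} [AddCommGroup L] [Module R L]
    (ℳ : G → AddSubgroup M) (𝒩 : G → AddSubgroup L)
    [DirectSum.Decomposition ℳ] [DirectSum.Decomposition 𝒩]
    (f : M →ₗ[R] L) (hf : ∀ g : G, ∀ m ∈ ℳ g, f m ∈ 𝒩 g)
    (hs : Function.Surjective f) (l : L) (hl : l ∈ ⋃ g, (𝒩 g : Set L)) :
    ∃ m ∈ ⋃ g, (ℳ g : Set M), f m = l := by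
  obtain ⟨g, hg⟩ := Set.mem_iUnion.1 hl
  obtain ⟨m, rfl⟩ := hs l
  have key : ∀ m : M, (DirectSum.decompose 𝒩 (f m) g : L)
      = f (DirectSum.decompose ℳ m g : M) := by
    intro m
    induction m using DirectSum.Decomposition.inductionOn ℳ with
    | zero => simp
    | @homogeneous i m =>
      by_cases h : i = g
      · subst h
        rw [DirectSum.decompose_of_mem_same 𝒩 (hf i m m.2),
          DirectSum.decompose_of_mem_same ℳ m.2]
      · rw [DirectSum.decompose_of_mem_ne 𝒩 (hf i m m.2) h,
          DirectSum.decompose_of_mem_ne ℳ m.2 h, map_zero]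
    | add a b ha hb =>
      simp [DirectSum.decompose_add, DirectSum.add_apply, ha, hb]
  refine ⟨(DirectSum.decompose ℳ m g : M), Set.mem_iUnion.2 ⟨g, SetLike.coe_mem _⟩, ?_⟩
  rw [← key, DirectSum.decompose_of_mem_same 𝒩 hg]

theorem Gr.comap_radical
    {R : Type*} [CommRing R]
    {M : Type*} [AddCommGroup M] [Module R M]
    {L : Type*} [AddCommGroup L] [Module R L]
    (HR : Set R) (HM : Set M) (HL : Set L)
    (f : M →ₗ[R] L) (hf : ∀ m ∈ HM, f m ∈ HL)
    (hlift : ∀ l ∈ HL, ∃ m ∈ HM, f m = l)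
    (hs : Function.Surjective f)
    (K : Submodule R M) (hK : Gr.IsGradedSubmodule HM K) (hker : LinearMap.ker f ≤ K)
    (m : M) (hm : m ∈ Gr.gradedRadical HR HM K) :
    f m ∈ Gr.gradedRadical HR HL (K.map f) := by
  unfold Gr.gradedRadical at hm ⊢
  rw [Submodule.mem_sInf] at hm ⊢
  rintro P ⟨⟨hP1, hP2, hP3⟩, hKP⟩
  have hKP' : K ≤ P.comap f := Submodule.map_le_iff_le_comap.1 hKP
  refine hm (P.comap f) ⟨⟨?_, ?_, ?_⟩, hKP'⟩
  · intro h
    apply hP1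
    rw [eq_top_iff]
    intro l _
    obtain ⟨n, rfl⟩ := hs l
    have : n ∈ P.comap f := h ▸ Submodule.mem_top
    exact this
  · intro n hn
    have h1 : f n ∈ Submodule.span R ((P : Set L) ∩ HL) := hP2 hn
    have h2 : Submodule.span R ((P : Set L) ∩ HL) ≤
        (Submodule.span R (((P.comap f : Submodule R M) : Set M) ∩ HM)).map f := by
      rw [Submodule.span_le]
      rintro l ⟨hl1, hl2⟩
      obtain ⟨a, ha, rfl⟩ := hlift l hl2
      exact ⟨a, Submodule.subset_span ⟨hl1, ha⟩, rfl⟩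
    obtain ⟨a, ha, hfa⟩ := h2 h1
    have hk : n - a ∈ K := hker (by simp [LinearMap.mem_ker, hfa])
    have h3 := Submodule.span_mono (R := R)
      (Set.inter_subset_inter_left HM (show (K : Set M) ⊆ (P.comap f : Submodule R M) from hKP')) (hK hk)
    have := Submodule.add_mem _ h3 ha
    rwa [sub_add_cancel] at this
  · intro r hr n hn hrn
    have hrn' : r • f n ∈ P := by rw [← map_smul]; exact hrn
    rcases hP3 r hr (f n) (hf n hn) hrn' with h | h
    · exact Or.inl h
    · right
      rw [Submodule.mem_colon] at h ⊢
      intro b _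
      rw [Submodule.mem_comap, map_smul]
      exact h (f b) trivial

/-- Let `f : M → L` be a graded `R`-epimorphism. If `K` is a graded
`φ`-2-absorbing primary submodule of `M` containing `Ker f` and `ψ(f(K)) = f(φ(K))`, then
`f(K)` is a graded `ψ`-2-absorbing primary submodule of `L`. -/
theorem map_graded_phiTwoAbsorbingPrimary
    {G : Type*} [Group G] [DecidableEq G]
    {R : Type*} [CommRing R] [Nontrivial R]
    {M : Type*} [AddCommGroup M] [Module R M]
    {L : Type*} [AddCommGroup L] [Module R L]
    (𝒜 : G → AddSubgroup R) (ℳ : G → AddSubgroup M) (𝒩 : G → AddSubgroup L)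
    [DirectSum.Decomposition 𝒜] [DirectSum.Decomposition ℳ] [DirectSum.Decomposition 𝒩]
    (hone : (1 : R) ∈ 𝒜 1)
    (hmul : ∀ {g h : G} {a b : R}, a ∈ 𝒜 g → b ∈ 𝒜 h → a * b ∈ 𝒜 (g * h))
    (hsmulM : ∀ {g h : G} {a : R} {m : M}, a ∈ 𝒜 g → m ∈ ℳ h → a • m ∈ ℳ (g * h))
    (hsmulL : ∀ {g h : G} {a : R} {x : L}, a ∈ 𝒜 g → x ∈ 𝒩 h → a • x ∈ 𝒩 (g * h))
    (φ : Submodule R M → Set M)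
    (hφsub : ∀ N : Submodule R M, Gr.IsGradedSubmodule (⋃ g, (ℳ g : Set M)) N → φ N ⊆ N)
    (hφgr : ∀ N : Submodule R M, Gr.IsGradedSubmodule (⋃ g, (ℳ g : Set M)) N →
      φ N = ∅ ∨ ∃ P : Submodule R M, Gr.IsGradedSubmodule (⋃ g, (ℳ g : Set M)) P ∧ φ N = ↑P)
    (ψ : Submodule R L → Set L)
    (hψsub : ∀ N : Submodule R L, Gr.IsGradedSubmodule (⋃ g, (𝒩 g : Set L)) N → ψ N ⊆ N)
    (hψgr : ∀ N : Submodule R L, Gr.IsGradedSubmodule (⋃ g, (𝒩 g : Set L)) N →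
      ψ N = ∅ ∨ ∃ P : Submodule R L, Gr.IsGradedSubmodule (⋃ g, (𝒩 g : Set L)) P ∧ ψ N = ↑P)
    (f : M →ₗ[R] L) (hfgraded : ∀ g : G, ∀ m ∈ ℳ g, f m ∈ 𝒩 g)
    (hfsurj : Function.Surjective f)
    (K : Submodule R M)
    (hK : Gr.IsGradedPhiTwoAbsorbingPrimary (⋃ g, (𝒜 g : Set R)) (⋃ g, (ℳ g : Set M)) (φ K) K)
    (hker : LinearMap.ker f ≤ K)
    (hcomp : ψ (K.map f) = ⇑f '' (φ K)) :
    Gr.IsGradedPhiTwoAbsorbingPrimary (⋃ g, (𝒜 g : Set R)) (⋃ g, (𝒩 g : Set L)) (ψ (K.map f)) (K.map f) := by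
  obtain ⟨hK1, hK2, hK3⟩ := hK
  have hlift := Gr.homog_lift ℳ 𝒩 f hfgraded hfsurj
  have hf : ∀ m ∈ ⋃ g, (ℳ g : Set M), f m ∈ ⋃ g, (𝒩 g : Set L) := by
    intro m hm
    obtain ⟨g, hg⟩ := Set.mem_iUnion.1 hm
    exact Set.mem_iUnion.2 ⟨g, hfgraded g m hg⟩
  have hback : ∀ m, f m ∈ K.map f → m ∈ K := by
    rintro m ⟨k, hk, hkm⟩
    have : m - k ∈ K := hker (by simp [LinearMap.mem_ker, hkm])
    have := K.add_mem this hk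
    rwa [sub_add_cancel] at this
  have hrad := Gr.comap_radical (⋃ g, (𝒜 g : Set R)) _ _ f hf hlift hfsurj K hK2 hker
  refine ⟨?_, ?_, ?_⟩
  · intro h
    apply hK1
    rw [eq_top_iff]
    intro m _
    exact hback m (h ▸ Submodule.mem_top)
  · rintro _ ⟨k, hk, rfl⟩
    have h1 := Submodule.mem_map_of_mem (f := f) (hK2 hk)
    rw [Submodule.map_span] at h1
    refine Submodule.span_mono ?_ h1
    rintro _ ⟨a, ⟨ha1, ha2⟩, rfl⟩
    exact ⟨⟨a, ha1, rfl⟩, hf a ha2⟩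
  · intro x hx y hy l hl hmem hnot
    obtain ⟨m, hm, rfl⟩ := hlift l hl
    rw [← map_smul, ← map_smul] at hmem hnot
    have hn : x • y • m ∉ φ K := fun h => hnot (hcomp ▸ ⟨_, h, rfl⟩)
    rcases hK3 x hx y hy m hm (hback _ hmem) hn with h | h | h
    · left; rw [← map_smul]; exact hrad _ h
    · right; left; rw [← map_smul]; exact hrad _ h
    · right; right
      rw [Submodule.mem_colon] at h ⊢
      intro b _
      obtain ⟨b, rfl⟩ := hfsurj b
      rw [← map_smul]
      exact Submodule.mem_map_of_mem (h b trivial)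
end

section
/- Let f : M → L be a graded R-epimorphism of graded R-modules, φ : GS(M) → GS(M) ∪ {∅} and ψ : GS(L) → GS(L) ∪ {∅} functions. If N is a graded ψ-2-absorbing R-submodule of L and φ(f⁻¹(N)) = f⁻¹(ψ(N)), then f⁻¹(N) is a graded φ-2-absorbing R-submodule of M. -/
/-- Let `f : M → L` be a graded `R`-epimorphism. If `N` is a graded
`ψ`-2-absorbing submodule of `L` and `φ(f⁻¹(N)) = f⁻¹(ψ(N))`, then `f⁻¹(N)` is a graded
`φ`-2-absorbing submodule of `M`. -/
theorem comap_graded_phiTwoAbsorbing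
    {G : Type*} [Group G] [DecidableEq G]
    {R : Type*} [CommRing R] [Nontrivial R]
    {M : Type*} [AddCommGroup M] [Module R M]
    {L : Type*} [AddCommGroup L] [Module R L]
    (𝒜 : G → AddSubgroup R) (ℳ : G → AddSubgroup M) (𝒩 : G → AddSubgroup L)
    [DirectSum.Decomposition 𝒜] [DirectSum.Decomposition ℳ] [DirectSum.Decomposition 𝒩]
    (hone : (1 : R) ∈ 𝒜 1)
    (hmul : ∀ {g h : G} {a b : R}, a ∈ 𝒜 g → b ∈ 𝒜 h → a * b ∈ 𝒜 (g * h))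
    (hsmulM : ∀ {g h : G} {a : R} {m : M}, a ∈ 𝒜 g → m ∈ ℳ h → a • m ∈ ℳ (g * h))
    (hsmulL : ∀ {g h : G} {a : R} {x : L}, a ∈ 𝒜 g → x ∈ 𝒩 h → a • x ∈ 𝒩 (g * h))
    (φ : Submodule R M → Set M)
    (hφsub : ∀ N : Submodule R M, Gr.IsGradedSubmodule (⋃ g, (ℳ g : Set M)) N → φ N ⊆ N)
    (hφgr : ∀ N : Submodule R M, Gr.IsGradedSubmodule (⋃ g, (ℳ g : Set M)) N →
      φ N = ∅ ∨ ∃ P : Submodule R M, Gr.IsGradedSubmodule (⋃ g, (ℳ g : Set M)) P ∧ φ N = ↑P)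
    (ψ : Submodule R L → Set L)
    (hψsub : ∀ N : Submodule R L, Gr.IsGradedSubmodule (⋃ g, (𝒩 g : Set L)) N → ψ N ⊆ N)
    (hψgr : ∀ N : Submodule R L, Gr.IsGradedSubmodule (⋃ g, (𝒩 g : Set L)) N →
      ψ N = ∅ ∨ ∃ P : Submodule R L, Gr.IsGradedSubmodule (⋃ g, (𝒩 g : Set L)) P ∧ ψ N = ↑P)
    (f : M →ₗ[R] L) (hfgraded : ∀ g : G, ∀ m ∈ ℳ g, f m ∈ 𝒩 g)
    (hfsurj : Function.Surjective f)
    (N : Submodule R L)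
    (hN : Gr.IsGradedPhiTwoAbsorbing (⋃ g, (𝒜 g : Set R)) (⋃ g, (𝒩 g : Set L)) (ψ N) N)
    (hcomp : φ (N.comap f) = ⇑f ⁻¹' (ψ N)) :
    Gr.IsGradedPhiTwoAbsorbing (⋃ g, (𝒜 g : Set R)) (⋃ g, (ℳ g : Set M)) (φ (N.comap f)) (N.comap f) := by
  classical
  obtain ⟨hNtop, hNgr, hNabs⟩ := hN
  -- elements of `N` are sums of homogeneous elements of `N`
  have hcl : ∀ x ∈ N, x ∈ AddSubgroup.closure ((N : Set L) ∩ ⋃ g, (𝒩 g : Set L)) := by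
    intro x hx
    have hx' := hNgr hx
    induction hx' using Submodule.span_induction with
    | mem x h => exact AddSubgroup.subset_closure h
    | zero => exact zero_mem _
    | add x y hx1 hy1 ihx ihy =>
      have key : ∀ z ∈ Submodule.span R ((N : Set L) ∩ ⋃ g, (𝒩 g : Set L)), z ∈ N := by
        intro z hz
        exact (Submodule.span_le.2 Set.inter_subset_left) hz
      exact add_mem (ihx (key _ hx1)) (ihy (key _ hy1))
    | smul r x hx1 ihx =>
      have hxN : x ∈ N := (Submodule.span_le.2 Set.inter_subset_left) hx1
      have hxc := ihx hxN
      clear ihx hx hx1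
      induction r using DirectSum.Decomposition.inductionOn 𝒜 with
      | zero => rw [zero_smul]; exact zero_mem _
      | add a b iha ihb => rw [add_smul]; exact add_mem iha ihb
      | @homogeneous i a =>
        clear hxN
        induction hxc using AddSubgroup.closure_induction with
        | mem y hy =>
          obtain ⟨hyN, hyH⟩ := hy
          obtain ⟨h, hh⟩ := Set.mem_iUnion.1 hyH
          exact AddSubgroup.subset_closure
            ⟨N.smul_mem _ hyN, Set.mem_iUnion.2 ⟨i * h, hsmulL a.2 hh⟩⟩
        | zero => rw [smul_zero]; exact zero_mem _
        | add y z _ _ ihy ihz => rw [smul_add]; exact add_mem ihy ihz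
        | neg y _ ihy => rw [smul_neg]; exact neg_mem ihy
  have hcomps : ∀ x ∈ N, ∀ g, (DirectSum.decompose 𝒩 x g : L) ∈ N := by
    intro x hx g
    have hxc := hcl x hx
    clear hx
    induction hxc using AddSubgroup.closure_induction with
    | mem y hy =>
      obtain ⟨hyN, hyH⟩ := hy
      obtain ⟨h, hh⟩ := Set.mem_iUnion.1 hyH
      by_cases e : h = g
      · subst e
        rw [DirectSum.decompose_of_mem_same 𝒩 hh]; exact hyN
      · rw [DirectSum.decompose_of_mem_ne 𝒩 hh e]; exact zero_mem _
    | zero => simp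
    | add y z _ _ ihy ihz =>
      rw [DirectSum.decompose_add]
      exact add_mem ihy ihz
    | neg y _ ihy =>
      rw [DirectSum.decompose_neg]
      exact neg_mem ihy
  have hfc : ∀ (m : M) (g : G),
      f (DirectSum.decompose ℳ m g : M) = (DirectSum.decompose 𝒩 (f m) g : L) := by
    intro m g
    induction m using DirectSum.Decomposition.inductionOn ℳ with
    | zero => simp
    | add a b iha ihb =>
      rw [DirectSum.decompose_add, map_add, DirectSum.decompose_add]
      simp only [DirectSum.add_apply, AddSubgroup.coe_add, map_add, iha, ihb]
    | @homogeneous i a =>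
      by_cases e : i = g
      · subst e
        rw [DirectSum.decompose_of_mem_same ℳ a.2,
          DirectSum.decompose_of_mem_same 𝒩 (hfgraded _ _ a.2)]
      · rw [DirectSum.decompose_of_mem_ne ℳ a.2 e,
          DirectSum.decompose_of_mem_ne 𝒩 (hfgraded _ _ a.2) e, map_zero]
  refine ⟨?_, ?_, ?_⟩
  · intro h
    apply hNtop
    rw [eq_top_iff]
    intro y _
    obtain ⟨m, rfl⟩ := hfsurj y
    have : m ∈ N.comap f := by rw [h]; trivial
    exact this
  · intro m hm
    rw [← DirectSum.sum_support_decompose ℳ m]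
    refine sum_mem fun g _ => Submodule.subset_span ⟨?_, Set.mem_iUnion.2 ⟨g, SetLike.coe_mem _⟩⟩
    change f _ ∈ N
    rw [hfc]
    exact hcomps _ hm g
  · intro x hx y hy m hm hK hφ
    obtain ⟨g, hg⟩ := Set.mem_iUnion.1 hm
    have e : f (x • y • m) = x • y • f m := by simp
    have h1 : x • y • f m ∈ N := e ▸ hK
    have h2 : x • y • f m ∉ ψ N := by
      intro h
      apply hφ
      rw [hcomp, Set.mem_preimage, e]
      exact h
    rcases hNabs x hx y hy (f m) (Set.mem_iUnion.2 ⟨g, hfgraded g m hg⟩) h1 h2 with h | h | h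
    · left; rw [Submodule.mem_comap, map_smul]; exact h
    · right; left; rw [Submodule.mem_comap, map_smul]; exact h
    · right; right
      rw [Submodule.mem_colon] at h ⊢
      intro z _
      rw [Submodule.mem_comap, map_smul]
      exact h _ trivial
end

section
/- Let S ⊆ h(R) be a multiplicatively closed set. If K is a graded φ-2-absorbing primary R-submodule of M and S⁻¹K ≠ S⁻¹M, then S⁻¹K is a graded φ_S-2-absorbing primary S⁻¹R-submodule of S⁻¹M. -/
namespace Gr

variable {G : Type*} [Group G] {R : Type*} [CommRing R]
  {M : Type*} [AddCommGroup M] [Module R M]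

/-- The localization `S⁻¹A` of a subset `A ⊆ M`, as a subset of `S⁻¹M`. -/
def locSet (S : Submonoid R) (A : Set M) : Set (LocalizedModule S M) :=
  {x | ∃ m ∈ A, ∃ s : S, x = LocalizedModule.mk m s}

/-- The `g`-th graded piece of `S⁻¹M`:
`(S⁻¹M)_g = {m/s : m ∈ M_h, s ∈ S ∩ R_{h g⁻¹}}`. -/
def locGradeM (𝒜 : G → AddSubgroup R) (ℳ : G → AddSubgroup M) (S : Submonoid R) (g : G) :
    Set (LocalizedModule S M) :=
  {x | ∃ h : G, ∃ m ∈ ℳ h, ∃ s : S, (s : R) ∈ 𝒜 (h * g⁻¹) ∧ x = LocalizedModule.mk m s}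

/-- The `g`-th graded piece of `S⁻¹R`:
`(S⁻¹R)_g = {a/s : a ∈ R_h, s ∈ S ∩ R_{h g⁻¹}}`. -/
def locGradeR (𝒜 : G → AddSubgroup R) (S : Submonoid R) (g : G) : Set (Localization S) :=
  {x | ∃ h : G, ∃ a ∈ 𝒜 h, ∃ s : S, (s : R) ∈ 𝒜 (h * g⁻¹) ∧ x = Localization.mk a s}

end Gr

namespace Gr

section Aux

variable {G : Type*} [Group G] [DecidableEq G] {R : Type*} [CommRing R]
  {M : Type*} [AddCommGroup M] [Module R M]

theorem aux_decompose_smul (𝒜 : G → AddSubgroup R) (ℳ : G → AddSubgroup M)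
    [DirectSum.Decomposition ℳ]
    (hsmul : ∀ {g h : G} {a : R} {m : M}, a ∈ 𝒜 g → m ∈ ℳ h → a • m ∈ ℳ (g * h))
    {k : G} {r : R} (hr : r ∈ 𝒜 k) (g : G) (x : M) :
    (DirectSum.decompose ℳ (r • x) (k * g) : M) = r • (DirectSum.decompose ℳ x g : M) := by
  induction x using DirectSum.Decomposition.inductionOn ℳ with
  | zero => simp
  | @homogeneous i m =>
    by_cases h : i = g
    · subst h
      rw [DirectSum.decompose_of_mem_same ℳ (hsmul hr m.2),
        DirectSum.decompose_of_mem_same ℳ m.2]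
    · rw [DirectSum.decompose_of_mem_ne ℳ (hsmul hr m.2) (by simpa using h),
        DirectSum.decompose_of_mem_ne ℳ m.2 h, smul_zero]
  | add a b ha hb =>
    simp only [smul_add, DirectSum.decompose_add, DirectSum.add_apply, AddSubgroup.coe_add, ha, hb]

theorem aux_span_decompose (𝒜 : G → AddSubgroup R) (ℳ : G → AddSubgroup M)
    [DirectSum.Decomposition 𝒜] [DirectSum.Decomposition ℳ]
    (hsmul : ∀ {g h : G} {a : R} {m : M}, a ∈ 𝒜 g → m ∈ ℳ h → a • m ∈ ℳ (g * h))
    (X : Set M) (hX : X ⊆ ⋃ g, (ℳ g : Set M)) {x : M} (hx : x ∈ Submodule.span R X) (g : G) :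
    (DirectSum.decompose ℳ x g : M) ∈ Submodule.span R X := by
  induction hx using Submodule.span_induction generalizing g with
  | mem x hx =>
    obtain ⟨i, hi⟩ := Set.mem_iUnion.1 (hX hx)
    by_cases h : i = g
    · subst h
      rw [DirectSum.decompose_of_mem_same ℳ hi]
      exact Submodule.subset_span hx
    · rw [DirectSum.decompose_of_mem_ne ℳ hi h]
      exact zero_mem _
  | zero => simp
  | add a b _ _ ha hb =>
    simp only [DirectSum.decompose_add, DirectSum.add_apply, AddSubgroup.coe_add]
    exact add_mem (ha g) (hb g)
  | smul r x _ hx =>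
    induction r using DirectSum.Decomposition.inductionOn 𝒜 with
    | zero => simp
    | @homogeneous i m =>
      have := aux_decompose_smul 𝒜 ℳ hsmul m.2 (i⁻¹ * g) x
      rw [mul_inv_cancel_left] at this
      rw [this]
      exact Submodule.smul_mem _ _ (hx _)
    | add a b ha hb =>
      simp only [add_smul, DirectSum.decompose_add, DirectSum.add_apply, AddSubgroup.coe_add]
      exact add_mem ha hb

theorem aux_mem_localized (S : Submonoid R) (K : Submodule R M) (x : LocalizedModule S M) :
    x ∈ K.localized S ↔ ∃ m ∈ K, ∃ s : S, LocalizedModule.mk m s = x := by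
  simp only [IsLocalizedModule.mk_eq_mk']
  exact Iff.rfl

theorem aux_mk_mem (S : Submonoid R) (P : Submodule (Localization S) (LocalizedModule S M))
    (m : M) (s t : S) (h : LocalizedModule.mk m s ∈ P) : LocalizedModule.mk m t ∈ P := by
  have : LocalizedModule.mk m t = Localization.mk (s : R) t • LocalizedModule.mk m s := by
    rw [LocalizedModule.mk_smul_mk, ← Submonoid.smul_def, LocalizedModule.mk_cancel_common_right]
  rw [this]
  exact P.smul_mem _ h

theorem aux_smul_mem (S : Submonoid R) (P : Submodule (Localization S) (LocalizedModule S M))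
    (m : M) (u t : S) (h : LocalizedModule.mk ((u : R) • m) 1 ∈ P) :
    LocalizedModule.mk m t ∈ P := by
  have h2 := aux_mk_mem S P _ 1 u h
  rw [← Submonoid.smul_def, LocalizedModule.mk_cancel] at h2
  exact aux_mk_mem S P _ _ _ h2

theorem aux_homM (𝒜 : G → AddSubgroup R) (ℳ : G → AddSubgroup M) (S : Submonoid R)
    (hS : ∀ s : S, ∃ g : G, (s : R) ∈ 𝒜 g) {m : M} (hm : m ∈ ⋃ g, (ℳ g : Set M)) (s : S) :
    LocalizedModule.mk m s ∈ ⋃ g, locGradeM 𝒜 ℳ S g := by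
  obtain ⟨h, hm⟩ := Set.mem_iUnion.1 hm
  obtain ⟨k, hk⟩ := hS s
  exact Set.mem_iUnion.2 ⟨k⁻¹ * h, h, m, hm, s, by simpa using hk, rfl⟩

theorem aux_homR (𝒜 : G → AddSubgroup R) (S : Submonoid R)
    (hS : ∀ s : S, ∃ g : G, (s : R) ∈ 𝒜 g) {a : R} (ha : a ∈ ⋃ g, (𝒜 g : Set R)) (s : S) :
    Localization.mk a s ∈ ⋃ g, locGradeR 𝒜 S g := by
  obtain ⟨h, ha⟩ := Set.mem_iUnion.1 ha
  obtain ⟨k, hk⟩ := hS s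
  exact Set.mem_iUnion.2 ⟨k⁻¹ * h, h, a, ha, s, by simpa using hk, rfl⟩

/-- Contraction of a graded prime is graded prime. -/
theorem aux_comap_prime (𝒜 : G → AddSubgroup R) (ℳ : G → AddSubgroup M)
    [DirectSum.Decomposition 𝒜] [DirectSum.Decomposition ℳ]
    (hsmul : ∀ {g h : G} {a : R} {m : M}, a ∈ 𝒜 g → m ∈ ℳ h → a • m ∈ ℳ (g * h))
    (S : Submonoid R) (hS : ∀ s : S, ∃ g : G, (s : R) ∈ 𝒜 g)
    (P' : Submodule (Localization S) (LocalizedModule S M))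
    (hP' : IsGradedPrime (⋃ g, locGradeR 𝒜 S g) (⋃ g, locGradeM 𝒜 ℳ S g) P')
    (P : Submodule R M) (hP : ∀ m, m ∈ P ↔ LocalizedModule.mk m (1 : S) ∈ P') :
    IsGradedPrime (⋃ g, (𝒜 g : Set R)) (⋃ g, (ℳ g : Set M)) P := by
  classical
  obtain ⟨h1, h2, h3⟩ := hP'
  refine ⟨?_, ?_, ?_⟩
  · rintro rfl
    apply h1
    rw [eq_top_iff]
    intro x _
    induction x using LocalizedModule.induction_on with
    | h m s => exact aux_mk_mem S P' m 1 s ((hP m).1 trivial)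
  · intro m hm
    set N := Submodule.span R ((P : Set M) ∩ ⋃ g, (ℳ g : Set M)) with hN
    have hNP : N ≤ P := Submodule.span_le.2 Set.inter_subset_left
    have hle : Submodule.span (Localization S) ((P' : Set (LocalizedModule S M)) ∩
        ⋃ g, locGradeM 𝒜 ℳ S g) ≤ N.localized S := by
      rw [Submodule.span_le]
      rintro x ⟨hx, hx2⟩
      obtain ⟨g, h, n, hn, s, -, rfl⟩ := Set.mem_iUnion.1 hx2
      refine (aux_mem_localized S N _).2 ⟨n, Submodule.subset_span ⟨?_, ?_⟩, s, rfl⟩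
      · exact (hP n).2 (aux_mk_mem S P' n s 1 hx)
      · exact Set.mem_iUnion.2 ⟨h, hn⟩
    obtain ⟨n, hn, s, hs⟩ := (aux_mem_localized S N _).1 (hle (h2 ((hP m).1 hm)))
    obtain ⟨u, hu⟩ := LocalizedModule.mk_eq.1 hs
    have hus : ((u * s : S) : R) • m ∈ N := by
      have : ((u * s : S) : R) • m = (u : R) • n := by
        rw [one_smul] at hu
        simp only [Submonoid.smul_def] at hu
        rw [hu, Submonoid.coe_mul, mul_smul]
      rw [this]
      exact N.smul_mem _ hn
    obtain ⟨k, hk⟩ := hS (u * s)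
    rw [← DirectSum.sum_support_decompose ℳ m]
    refine Submodule.sum_mem _ fun g _ => Submodule.subset_span ⟨?_, ?_⟩
    · have h4 := aux_span_decompose 𝒜 ℳ hsmul _ Set.inter_subset_right hus (k * g)
      rw [aux_decompose_smul 𝒜 ℳ hsmul hk] at h4
      exact (hP _).2 (aux_smul_mem S P' _ _ _ ((hP _).1 (hNP h4)))
    · exact Set.mem_iUnion.2 ⟨g, (DirectSum.decompose ℳ m g).2⟩
  · intro r hr m hm hrm
    have h4 := h3 (Localization.mk r 1) (aux_homR 𝒜 S hS hr 1) (LocalizedModule.mk m 1)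
      (aux_homM 𝒜 ℳ S hS hm 1) (by
        rw [LocalizedModule.mk_smul_mk, mul_one]; exact (hP _).1 hrm)
    refine h4.imp (hP m).2 fun h => Submodule.mem_colon.2 fun n _ => (hP _).2 ?_
    have := Submodule.mem_colon.1 h (LocalizedModule.mk n 1) trivial
    rwa [LocalizedModule.mk_smul_mk, mul_one] at this

theorem aux_radical (𝒜 : G → AddSubgroup R) (ℳ : G → AddSubgroup M)
    [DirectSum.Decomposition 𝒜] [DirectSum.Decomposition ℳ]
    (hsmul : ∀ {g h : G} {a : R} {m : M}, a ∈ 𝒜 g → m ∈ ℳ h → a • m ∈ ℳ (g * h))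
    (S : Submonoid R) (hS : ∀ s : S, ∃ g : G, (s : R) ∈ 𝒜 g) (K : Submodule R M) {m : M}
    (hm : m ∈ gradedRadical (⋃ g, (𝒜 g : Set R)) (⋃ g, (ℳ g : Set M)) K) (s : S) :
    LocalizedModule.mk m s ∈ gradedRadical (⋃ g, locGradeR 𝒜 S g)
      (⋃ g, locGradeM 𝒜 ℳ S g) (K.localized S) := by
  refine Submodule.mem_sInf.2 ?_
  rintro P' ⟨hP', hK⟩
  let P : Submodule R M :=
    (P'.restrictScalars R).comap (LocalizedModule.mkLinearMap S M)
  have hP : ∀ m, m ∈ P ↔ LocalizedModule.mk m (1 : S) ∈ P' := fun m => Iff.rfl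
  have := Submodule.mem_sInf.1 hm P ⟨aux_comap_prime 𝒜 ℳ hsmul S hS P' hP' P hP, fun k hk =>
    (hP k).2 (hK ((aux_mem_localized S K _).2 ⟨k, hk, 1, rfl⟩))⟩
  exact aux_mk_mem S P' m 1 s ((hP m).1 this)

end Aux

end Gr

/-- Let `S ⊆ h(R)` be a multiplicatively closed set. If `K` is a graded
`φ`-2-absorbing primary submodule of `M` and `S⁻¹K ≠ S⁻¹M`, then `S⁻¹K` is a graded
`φ_S`-2-absorbing primary `S⁻¹R`-submodule of `S⁻¹M`, where `φ_S(S⁻¹K) = S⁻¹(φ(K))`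
(which is `∅` when `φ(K) = ∅`). -/
theorem localization_graded_phiTwoAbsorbingPrimary
    {G : Type*} [Group G] [DecidableEq G]
    {R : Type*} [CommRing R] [Nontrivial R]
    {M : Type*} [AddCommGroup M] [Module R M]
    (𝒜 : G → AddSubgroup R) (ℳ : G → AddSubgroup M)
    [DirectSum.Decomposition 𝒜] [DirectSum.Decomposition ℳ]
    (hone : (1 : R) ∈ 𝒜 1)
    (hmul : ∀ {g h : G} {a b : R}, a ∈ 𝒜 g → b ∈ 𝒜 h → a * b ∈ 𝒜 (g * h))
    (hsmul : ∀ {g h : G} {a : R} {m : M}, a ∈ 𝒜 g → m ∈ ℳ h → a • m ∈ ℳ (g * h))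
    (φ : Submodule R M → Set M)
    (hφsub : ∀ N : Submodule R M, Gr.IsGradedSubmodule (⋃ g, (ℳ g : Set M)) N → φ N ⊆ N)
    (hφgr : ∀ N : Submodule R M, Gr.IsGradedSubmodule (⋃ g, (ℳ g : Set M)) N →
      φ N = ∅ ∨ ∃ P : Submodule R M, Gr.IsGradedSubmodule (⋃ g, (ℳ g : Set M)) P ∧ φ N = ↑P)
    (S : Submonoid R) (hS : ∀ s : S, ∃ g : G, (s : R) ∈ 𝒜 g)
    (K : Submodule R M)
    (hK : Gr.IsGradedPhiTwoAbsorbingPrimary (⋃ g, (𝒜 g : Set R)) (⋃ g, (ℳ g : Set M)) (φ K) K)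
    (hproper : K.localized S ≠ ⊤) :
    Gr.IsGradedPhiTwoAbsorbingPrimary (⋃ g, Gr.locGradeR 𝒜 S g)
      (⋃ g, Gr.locGradeM 𝒜 ℳ S g) (Gr.locSet S (φ K)) (K.localized S) := by

  obtain ⟨-, hgr, habs⟩ := hK
  refine ⟨hproper, ?_, ?_⟩
  · intro x hx
    obtain ⟨k, hk, s, rfl⟩ := (Gr.aux_mem_localized S K x).1 hx
    refine Gr.aux_mk_mem S _ k 1 s ?_
    have hle : Submodule.span R ((K : Set M) ∩ ⋃ g, (ℳ g : Set M)) ≤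
        ((Submodule.span (Localization S) (((K.localized S : Submodule (Localization S)
          (LocalizedModule S M)) : Set (LocalizedModule S M)) ∩
          ⋃ g, Gr.locGradeM 𝒜 ℳ S g)).restrictScalars R).comap
            (LocalizedModule.mkLinearMap S M) := by
      rw [Submodule.span_le]
      rintro n ⟨hn, hn2⟩
      exact Submodule.subset_span (s := ((K.localized S : Submodule (Localization S)
          (LocalizedModule S M)) : Set (LocalizedModule S M)) ∩ ⋃ g, Gr.locGradeM 𝒜 ℳ S g)
        ⟨(Gr.aux_mem_localized S K _).2 ⟨n, hn, 1, rfl⟩, Gr.aux_homM 𝒜 ℳ S hS hn2 1⟩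
    exact hle (hgr hk)
  · intro x hx y hy m hm hxy hφ
    obtain ⟨_, ga, a, ha, s, -, rfl⟩ := Set.mem_iUnion.1 hx
    obtain ⟨_, gb, b, hb, t, -, rfl⟩ := Set.mem_iUnion.1 hy
    obtain ⟨_, gn, n, hn, u, -, rfl⟩ := Set.mem_iUnion.1 hm
    rw [LocalizedModule.mk_smul_mk, LocalizedModule.mk_smul_mk] at hxy hφ
    obtain ⟨k, hk, w, hw⟩ := (Gr.aux_mem_localized S K _).1 hxy
    obtain ⟨v, hv⟩ := LocalizedModule.mk_eq.1 hw
    simp only [Submonoid.smul_def] at hv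
    set c : S := v * w with hc
    obtain ⟨gc, hgc⟩ := hS c
    have e1 : a • b • (c : R) • n = (c : R) • a • b • n := by
      rw [smul_comm b, smul_comm a]
    have e2 : (c : R) • a • b • n = (v : R) • ((s * (t * u) : S) : R) • k := by
      rw [hv, hc, Submonoid.coe_mul, mul_smul]
    have hin : a • b • (c : R) • n ∈ K := by
      rw [e1, e2]
      exact K.smul_mem _ (K.smul_mem _ hk)
    have hnot : a • b • (c : R) • n ∉ φ K := by
      intro h
      refine hφ ⟨_, h, c * (s * (t * u)), ?_⟩
      rw [e1, ← Submonoid.smul_def, LocalizedModule.mk_cancel_common_left]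
    have key := habs a (Set.mem_iUnion.2 ⟨_, ha⟩) b (Set.mem_iUnion.2 ⟨_, hb⟩) ((c : R) • n)
      (Set.mem_iUnion.2 ⟨_, hsmul hgc hn⟩) hin hnot
    rw [LocalizedModule.mk_smul_mk, LocalizedModule.mk_smul_mk]
    refine key.imp (fun h => ?_) (Or.imp (fun h => ?_) fun h => ?_)
    · rw [smul_comm] at h
      exact Gr.aux_smul_mem S _ _ c _ (Gr.aux_radical 𝒜 ℳ hsmul S hS K h 1)
    · rw [smul_comm] at h
      exact Gr.aux_smul_mem S _ _ c _ (Gr.aux_radical 𝒜 ℳ hsmul S hS K h 1)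
    · refine Submodule.mem_colon.2 fun z _ => ?_
      induction z using LocalizedModule.induction_on with
      | h z q =>
        rw [Localization.mk_mul, LocalizedModule.mk_smul_mk]
        exact (Gr.aux_mem_localized S K _).2 ⟨_, Submodule.mem_colon.1 h z trivial, _, rfl⟩
end

section
/- Let S ⊆ h(R) be a multiplicatively closed set. If K is a graded φ-2-absorbing R-submodule of M and S⁻¹K ≠ S⁻¹M, then S⁻¹K is a graded φ_S-2-absorbing S⁻¹R-submodule of S⁻¹M. -/
/-- Let `S ⊆ h(R)` be a multiplicatively closed set. If `K` is a graded
`φ`-2-absorbing submodule of `M` and `S⁻¹K ≠ S⁻¹M`, then `S⁻¹K` is a graded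
`φ_S`-2-absorbing `S⁻¹R`-submodule of `S⁻¹M`, where `φ_S(S⁻¹K) = S⁻¹(φ(K))`
(which is `∅` when `φ(K) = ∅`). -/
theorem localization_graded_phiTwoAbsorbing
    {G : Type*} [Group G] [DecidableEq G]
    {R : Type*} [CommRing R] [Nontrivial R]
    {M : Type*} [AddCommGroup M] [Module R M]
    (𝒜 : G → AddSubgroup R) (ℳ : G → AddSubgroup M)
    [DirectSum.Decomposition 𝒜] [DirectSum.Decomposition ℳ]
    (hone : (1 : R) ∈ 𝒜 1)
    (hmul : ∀ {g h : G} {a b : R}, a ∈ 𝒜 g → b ∈ 𝒜 h → a * b ∈ 𝒜 (g * h))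
    (hsmul : ∀ {g h : G} {a : R} {m : M}, a ∈ 𝒜 g → m ∈ ℳ h → a • m ∈ ℳ (g * h))
    (φ : Submodule R M → Set M)
    (hφsub : ∀ N : Submodule R M, Gr.IsGradedSubmodule (⋃ g, (ℳ g : Set M)) N → φ N ⊆ N)
    (hφgr : ∀ N : Submodule R M, Gr.IsGradedSubmodule (⋃ g, (ℳ g : Set M)) N →
      φ N = ∅ ∨ ∃ P : Submodule R M, Gr.IsGradedSubmodule (⋃ g, (ℳ g : Set M)) P ∧ φ N = ↑P)
    (S : Submonoid R) (hS : ∀ s : S, ∃ g : G, (s : R) ∈ 𝒜 g)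
    (K : Submodule R M)
    (hK : Gr.IsGradedPhiTwoAbsorbing (⋃ g, (𝒜 g : Set R)) (⋃ g, (ℳ g : Set M)) (φ K) K)
    (hproper : K.localized S ≠ ⊤) :
    Gr.IsGradedPhiTwoAbsorbing (⋃ g, Gr.locGradeR 𝒜 S g)
      (⋃ g, Gr.locGradeM 𝒜 ℳ S g) (Gr.locSet S (φ K)) (K.localized S) := by
  classical
  have memloc : ∀ (n : M) (s : S), n ∈ K → LocalizedModule.mk n s ∈ K.localized S := by
    intro n s hn
    rw [Submodule.mem_localized']
    exact ⟨n, hn, s, by rw [← IsLocalizedModule.mk_eq_mk']⟩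
  obtain ⟨-, hgr, habs⟩ := hK
  refine ⟨hproper, ?_, ?_⟩
  · intro z hz
    rw [Submodule.mem_localized'] at hz
    obtain ⟨k, hk, s, rfl⟩ := hz
    rw [← IsLocalizedModule.mk_eq_mk']
    have key : LocalizedModule.mk k (1 : S) ∈ Submodule.span (Localization S)
        ((K.localized S : Set (LocalizedModule S M)) ∩ ⋃ g, Gr.locGradeM 𝒜 ℳ S g) := by
      have h1 := hgr hk
      clear hk
      induction h1 using Submodule.span_induction with
      | mem x hx =>
        apply Submodule.subset_span
        refine ⟨memloc _ _ hx.1, ?_⟩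
        obtain ⟨g, hg⟩ := Set.mem_iUnion.1 hx.2
        refine Set.mem_iUnion.2 ⟨g, g, x, hg, 1, ?_, rfl⟩
        simpa using hone
      | zero => rw [LocalizedModule.zero_mk]; exact Submodule.zero_mem _
      | add x y _ _ hx hy =>
        have := Submodule.add_mem _ hx hy
        simpa [LocalizedModule.mk_add_mk] using this
      | smul a x _ hx =>
        have := Submodule.smul_mem _ (Localization.mk a (1 : S)) hx
        simpa [LocalizedModule.mk_smul_mk] using this
    have := Submodule.smul_mem _ (Localization.mk (1 : R) s) key
    simpa [LocalizedModule.mk_smul_mk] using this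
  · intro x hx y hy m hm h1 h2
    obtain ⟨_, _, a, ha, s, -, rfl⟩ := Set.mem_iUnion.1 hx
    obtain ⟨_, _, b, hb, t, -, rfl⟩ := Set.mem_iUnion.1 hy
    obtain ⟨_, _, n, hn, u, -, rfl⟩ := Set.mem_iUnion.1 hm
    simp only [LocalizedModule.mk_smul_mk] at h1 h2 ⊢
    rw [Submodule.mem_localized'] at h1
    obtain ⟨k, hk, w, hkw⟩ := h1
    rw [← IsLocalizedModule.mk_eq_mk', LocalizedModule.mk_eq] at hkw
    obtain ⟨c, hc⟩ := hkw
    let v : S := c * w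
    have hv : a • b • (v • n) = c • (s * (t * u)) • k := by
      rw [hc]
      simp only [v, Submonoid.smul_def, smul_smul, Submonoid.coe_mul]
      congr 1; ring
    obtain ⟨gv, hgv⟩ := hS v
    have cancel : ∀ (p : M) (q : S), LocalizedModule.mk p q = LocalizedModule.mk (v • p) (v * q) :=
      fun p q => (LocalizedModule.mk_cancel_common_left v q p).symm
    have hc1 : ∀ r : R, v • r • n = r • v • n := fun r => smul_comm _ _ _
    rcases habs a (Set.mem_iUnion.2 ⟨_, ha⟩) b (Set.mem_iUnion.2 ⟨_, hb⟩) (v • n)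
      (Set.mem_iUnion.2 ⟨_, hsmul hgv hn⟩) (by
        rw [hv]; exact K.smul_mem _ (K.smul_mem _ hk)) (by
        intro h
        apply h2
        refine ⟨_, h, v * (s * (t * u)), ?_⟩
        rw [cancel (a • b • n), smul_comm v a, smul_comm v b]) with h | h | h
    · left
      rw [cancel, hc1]; exact memloc _ _ h
    · right; left
      rw [cancel, hc1]; exact memloc _ _ h
    · right; right
      rw [Submodule.mem_colon] at h ⊢
      intro p _
      induction p using LocalizedModule.induction_on with
      | h p q =>
      rw [Localization.mk_mul, LocalizedModule.mk_smul_mk]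
      exact memloc _ _ (h p trivial)
end

section
/- Let R = R₁ × R₂ and M = M₁ × M₂, with φ = φ₁ × φ₂, and let K = K₁ × M₂ for some proper graded R₁-submodule K₁ of M₁. If K is a graded φ-2-absorbing R-submodule of M, then K₁ is a graded φ₁-2-absorbing R₁-submodule of M₁. -/
namespace Gr

section Prod

variable {R₁ R₂ M₁ M₂ : Type*} [CommRing R₁] [CommRing R₂]
  [AddCommGroup M₁] [AddCommGroup M₂] [Module R₁ M₁] [Module R₂ M₂]

/-- `M₁` as a module over `R₁ × R₂`, acting through the first projection. -/
instance fstModule : Module (R₁ × R₂) M₁ := Module.compHom M₁ (RingHom.fst R₁ R₂)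

/-- `M₂` as a module over `R₁ × R₂`, acting through the second projection. -/
instance sndModule : Module (R₁ × R₂) M₂ := Module.compHom M₂ (RingHom.snd R₁ R₂)

/-- `K₁ × K₂` as an `R₁ × R₂`-submodule of `M₁ × M₂` (componentwise action). -/
def prodSub (K₁ : Submodule R₁ M₁) (K₂ : Submodule R₂ M₂) :
    Submodule (R₁ × R₂) (M₁ × M₂) where
  carrier := (K₁ : Set M₁) ×ˢ (K₂ : Set M₂)
  add_mem' := fun h h' => ⟨K₁.add_mem h.1 h'.1, K₂.add_mem h.2 h'.2⟩
  zero_mem' := ⟨K₁.zero_mem, K₂.zero_mem⟩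
  smul_mem' := fun r _ h => ⟨K₁.smul_mem r.1 h.1, K₂.smul_mem r.2 h.2⟩

end Prod

end Gr

/-- Let `R = R₁ × R₂`, `M = M₁ × M₂`, `φ = φ₁ × φ₂`, and `K = K₁ × M₂` for
a proper graded `R₁`-submodule `K₁` of `M₁`. If `K` is a graded `φ`-2-absorbing `R`-submodule
of `M`, then `K₁` is a graded `φ₁`-2-absorbing `R₁`-submodule of `M₁`. -/
theorem prod_graded_phiTwoAbsorbing_left
    {G : Type*} [Group G] [DecidableEq G]
    {R₁ R₂ M₁ M₂ : Type*} [CommRing R₁] [CommRing R₂] [Nontrivial R₁] [Nontrivial R₂]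
    [AddCommGroup M₁] [AddCommGroup M₂] [Module R₁ M₁] [Module R₂ M₂]
    (𝒜₁ : G → AddSubgroup R₁) (ℳ₁ : G → AddSubgroup M₁)
    (𝒜₂ : G → AddSubgroup R₂) (ℳ₂ : G → AddSubgroup M₂)
    [DirectSum.Decomposition 𝒜₁] [DirectSum.Decomposition ℳ₁]
    [DirectSum.Decomposition 𝒜₂] [DirectSum.Decomposition ℳ₂]
    (hone₁ : (1 : R₁) ∈ 𝒜₁ 1) (hone₂ : (1 : R₂) ∈ 𝒜₂ 1)
    (hmul₁ : ∀ {g h : G} {a b : R₁}, a ∈ 𝒜₁ g → b ∈ 𝒜₁ h → a * b ∈ 𝒜₁ (g * h))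
    (hmul₂ : ∀ {g h : G} {a b : R₂}, a ∈ 𝒜₂ g → b ∈ 𝒜₂ h → a * b ∈ 𝒜₂ (g * h))
    (hsmul₁ : ∀ {g h : G} {a : R₁} {m : M₁}, a ∈ 𝒜₁ g → m ∈ ℳ₁ h → a • m ∈ ℳ₁ (g * h))
    (hsmul₂ : ∀ {g h : G} {a : R₂} {m : M₂}, a ∈ 𝒜₂ g → m ∈ ℳ₂ h → a • m ∈ ℳ₂ (g * h))
    (φ₁ : Submodule R₁ M₁ → Set M₁)
    (hφ₁sub : ∀ N : Submodule R₁ M₁,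
      Gr.IsGradedSubmodule (⋃ g, (ℳ₁ g : Set M₁)) N → φ₁ N ⊆ N)
    (hφ₁gr : ∀ N : Submodule R₁ M₁, Gr.IsGradedSubmodule (⋃ g, (ℳ₁ g : Set M₁)) N →
      φ₁ N = ∅ ∨ ∃ P : Submodule R₁ M₁,
        Gr.IsGradedSubmodule (⋃ g, (ℳ₁ g : Set M₁)) P ∧ φ₁ N = ↑P)
    (φ₂ : Submodule R₂ M₂ → Set M₂)
    (hφ₂sub : ∀ N : Submodule R₂ M₂,
      Gr.IsGradedSubmodule (⋃ g, (ℳ₂ g : Set M₂)) N → φ₂ N ⊆ N)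
    (hφ₂gr : ∀ N : Submodule R₂ M₂, Gr.IsGradedSubmodule (⋃ g, (ℳ₂ g : Set M₂)) N →
      φ₂ N = ∅ ∨ ∃ P : Submodule R₂ M₂,
        Gr.IsGradedSubmodule (⋃ g, (ℳ₂ g : Set M₂)) P ∧ φ₂ N = ↑P)
    (K₁ : Submodule R₁ M₁) (hK₁proper : K₁ ≠ ⊤)
    (hK₁graded : Gr.IsGradedSubmodule (⋃ g, (ℳ₁ g : Set M₁)) K₁)
    (hK : Gr.IsGradedPhiTwoAbsorbing (⋃ g, ((𝒜₁ g : Set R₁) ×ˢ (𝒜₂ g : Set R₂))) (⋃ g, ((ℳ₁ g : Set M₁) ×ˢ (ℳ₂ g : Set M₂))) ((φ₁ K₁) ×ˢ (φ₂ ⊤)) (Gr.prodSub K₁ (⊤ : Submodule R₂ M₂))) :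
    Gr.IsGradedPhiTwoAbsorbing (⋃ g, (𝒜₁ g : Set R₁)) (⋃ g, (ℳ₁ g : Set M₁)) (φ₁ K₁) K₁ := by
  refine ⟨hK₁proper, hK₁graded, ?_⟩
  intro x hx y hy m hm hxy hn
  obtain ⟨g, hg⟩ := Set.mem_iUnion.1 hx
  obtain ⟨h, hh⟩ := Set.mem_iUnion.1 hy
  obtain ⟨k, hk⟩ := Set.mem_iUnion.1 hm
  rcases hK.2.2 (x, 0) (Set.mem_iUnion.2 ⟨g, hg, (𝒜₂ g).zero_mem⟩)
    (y, 0) (Set.mem_iUnion.2 ⟨h, hh, (𝒜₂ h).zero_mem⟩)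
    (m, 0) (Set.mem_iUnion.2 ⟨k, hk, (ℳ₂ k).zero_mem⟩)
    ⟨hxy, Submodule.mem_top⟩ (fun h' => hn h'.1) with h1 | h1 | h1
  · exact Or.inl h1.1
  · exact Or.inr (Or.inl h1.1)
  · refine Or.inr (Or.inr ?_)
    rw [Submodule.mem_colon] at h1 ⊢
    intro p _
    exact (h1 (p, 0) trivial).1
end

section
/- Let R = R₁ × R₂ and M = M₁ × M₂, with φ = φ₁ × φ₂, let K = K₁ × M₂ for some proper graded R₁-submodule K₁ of M₁, and suppose φ₂(M₂) = M₂. Then K is a graded φ-2-absorbing R-submodule of M if and only if K₁ is a graded φ₁-2-absorbing R₁-submodule of M₁. -/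
/-- Let `R = R₁ × R₂`, `M = M₁ × M₂`, `φ = φ₁ × φ₂`, `K = K₁ × M₂` for a
proper graded `R₁`-submodule `K₁` of `M₁`, and suppose `φ₂(M₂) = M₂`. Then `K` is a graded
`φ`-2-absorbing `R`-submodule of `M` iff `K₁` is a graded `φ₁`-2-absorbing `R₁`-submodule
of `M₁`. -/
theorem prod_graded_phiTwoAbsorbing_iff_of_phi₂_top
    {G : Type*} [Group G] [DecidableEq G]
    {R₁ R₂ M₁ M₂ : Type*} [CommRing R₁] [CommRing R₂] [Nontrivial R₁] [Nontrivial R₂]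
    [AddCommGroup M₁] [AddCommGroup M₂] [Module R₁ M₁] [Module R₂ M₂]
    (𝒜₁ : G → AddSubgroup R₁) (ℳ₁ : G → AddSubgroup M₁)
    (𝒜₂ : G → AddSubgroup R₂) (ℳ₂ : G → AddSubgroup M₂)
    [DirectSum.Decomposition 𝒜₁] [DirectSum.Decomposition ℳ₁]
    [DirectSum.Decomposition 𝒜₂] [DirectSum.Decomposition ℳ₂]
    (hone₁ : (1 : R₁) ∈ 𝒜₁ 1) (hone₂ : (1 : R₂) ∈ 𝒜₂ 1)
    (hmul₁ : ∀ {g h : G} {a b : R₁}, a ∈ 𝒜₁ g → b ∈ 𝒜₁ h → a * b ∈ 𝒜₁ (g * h))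
    (hmul₂ : ∀ {g h : G} {a b : R₂}, a ∈ 𝒜₂ g → b ∈ 𝒜₂ h → a * b ∈ 𝒜₂ (g * h))
    (hsmul₁ : ∀ {g h : G} {a : R₁} {m : M₁}, a ∈ 𝒜₁ g → m ∈ ℳ₁ h → a • m ∈ ℳ₁ (g * h))
    (hsmul₂ : ∀ {g h : G} {a : R₂} {m : M₂}, a ∈ 𝒜₂ g → m ∈ ℳ₂ h → a • m ∈ ℳ₂ (g * h))
    (φ₁ : Submodule R₁ M₁ → Set M₁)
    (hφ₁sub : ∀ N : Submodule R₁ M₁,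
      Gr.IsGradedSubmodule (⋃ g, (ℳ₁ g : Set M₁)) N → φ₁ N ⊆ N)
    (hφ₁gr : ∀ N : Submodule R₁ M₁, Gr.IsGradedSubmodule (⋃ g, (ℳ₁ g : Set M₁)) N →
      φ₁ N = ∅ ∨ ∃ P : Submodule R₁ M₁,
        Gr.IsGradedSubmodule (⋃ g, (ℳ₁ g : Set M₁)) P ∧ φ₁ N = ↑P)
    (φ₂ : Submodule R₂ M₂ → Set M₂)
    (hφ₂sub : ∀ N : Submodule R₂ M₂,
      Gr.IsGradedSubmodule (⋃ g, (ℳ₂ g : Set M₂)) N → φ₂ N ⊆ N)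
    (hφ₂gr : ∀ N : Submodule R₂ M₂, Gr.IsGradedSubmodule (⋃ g, (ℳ₂ g : Set M₂)) N →
      φ₂ N = ∅ ∨ ∃ P : Submodule R₂ M₂,
        Gr.IsGradedSubmodule (⋃ g, (ℳ₂ g : Set M₂)) P ∧ φ₂ N = ↑P)
    (K₁ : Submodule R₁ M₁) (hK₁proper : K₁ ≠ ⊤)
    (hK₁graded : Gr.IsGradedSubmodule (⋃ g, (ℳ₁ g : Set M₁)) K₁)
    (hφ₂top : φ₂ ⊤ = (Set.univ : Set M₂)) :
    Gr.IsGradedPhiTwoAbsorbing (⋃ g, ((𝒜₁ g : Set R₁) ×ˢ (𝒜₂ g : Set R₂))) (⋃ g, ((ℳ₁ g : Set M₁) ×ˢ (ℳ₂ g : Set M₂))) ((φ₁ K₁) ×ˢ (φ₂ ⊤)) (Gr.prodSub K₁ (⊤ : Submodule R₂ M₂)) ↔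
      Gr.IsGradedPhiTwoAbsorbing (⋃ g, (𝒜₁ g : Set R₁)) (⋃ g, (ℳ₁ g : Set M₁)) (φ₁ K₁) K₁ := by
  have hgr : Gr.IsGradedSubmodule (⋃ g, ((ℳ₁ g : Set M₁) ×ˢ (ℳ₂ g : Set M₂)))
      (Gr.prodSub K₁ (⊤ : Submodule R₂ M₂)) := by
    rintro ⟨k, m⟩ ⟨hk, -⟩
    have h1 : ((k, 0) : M₁ × M₂) ∈ Submodule.span (R₁ × R₂)
        ((Gr.prodSub K₁ (⊤ : Submodule R₂ M₂) : Set (M₁ × M₂)) ∩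
          (⋃ g, ((ℳ₁ g : Set M₁) ×ˢ (ℳ₂ g : Set M₂)))) := by
      have hk' : k ∈ Submodule.span R₁ ((K₁ : Set M₁) ∩ ⋃ g, (ℳ₁ g : Set M₁)) := hK₁graded hk
      clear hk
      induction hk' using Submodule.span_induction with
      | mem x hx =>
        obtain ⟨hx, hx'⟩ := hx
        obtain ⟨g, hg⟩ := Set.mem_iUnion.1 hx'
        exact Submodule.subset_span ⟨⟨hx, trivial⟩,
          Set.mem_iUnion.2 ⟨g, hg, (ℳ₂ g).zero_mem⟩⟩
      | zero => exact Submodule.zero_mem _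
      | add x y _ _ hx hy =>
        have := Submodule.add_mem _ hx hy
        rwa [Prod.mk_add_mk, add_zero] at this
      | smul r x _ hx =>
        have := Submodule.smul_mem _ ((r, 0) : R₁ × R₂) hx
        have e : ((r, 0) : R₁ × R₂) • ((x, 0) : M₁ × M₂) = (r • x, 0) :=
          Prod.ext rfl (smul_zero (0 : R₂))
        rwa [e] at this
    have h2 : ((0, m) : M₁ × M₂) ∈ Submodule.span (R₁ × R₂)
        ((Gr.prodSub K₁ (⊤ : Submodule R₂ M₂) : Set (M₁ × M₂)) ∩
          (⋃ g, ((ℳ₁ g : Set M₁) ×ˢ (ℳ₂ g : Set M₂)))) := by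
      clear h1 hk
      induction m using DirectSum.Decomposition.inductionOn ℳ₂ with
      | zero => exact Submodule.zero_mem _
      | @homogeneous i x =>
        exact Submodule.subset_span ⟨⟨K₁.zero_mem, trivial⟩,
          Set.mem_iUnion.2 ⟨i, (ℳ₁ i).zero_mem, x.2⟩⟩
      | add x y hx hy =>
        have := Submodule.add_mem _ hx hy
        rwa [Prod.mk_add_mk, add_zero] at this
    have := Submodule.add_mem _ h1 h2
    rwa [Prod.mk_add_mk, add_zero, zero_add] at this
  constructor
  · rintro ⟨-, -, h⟩
    refine ⟨hK₁proper, hK₁graded, ?_⟩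
    intro x hx y hy m hm hK hφ
    obtain ⟨g, hx⟩ := Set.mem_iUnion.1 hx
    obtain ⟨g', hy⟩ := Set.mem_iUnion.1 hy
    obtain ⟨g'', hm⟩ := Set.mem_iUnion.1 hm
    rcases h (x, 0) (Set.mem_iUnion.2 ⟨g, hx, (𝒜₂ g).zero_mem⟩)
      (y, 0) (Set.mem_iUnion.2 ⟨g', hy, (𝒜₂ g').zero_mem⟩)
      (m, 0) (Set.mem_iUnion.2 ⟨g'', hm, (ℳ₂ g'').zero_mem⟩)
      ⟨hK, trivial⟩ (fun h => hφ h.1) with h | h | h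
    · exact Or.inl h.1
    · exact Or.inr (Or.inl h.1)
    · refine Or.inr (Or.inr ?_)
      rw [Submodule.mem_colon] at h ⊢
      intro p _
      exact (h (p, 0) trivial).1
  · rintro ⟨-, -, h⟩
    refine ⟨?_, hgr, ?_⟩
    · intro e
      apply hK₁proper
      rw [eq_top_iff]
      intro p _
      have : ((p, 0) : M₁ × M₂) ∈ Gr.prodSub K₁ (⊤ : Submodule R₂ M₂) := by
        rw [e]; trivial
      exact this.1
    · intro x hx y hy m hm hK hφ
      obtain ⟨g, hx⟩ := Set.mem_iUnion.1 hx
      obtain ⟨g', hy⟩ := Set.mem_iUnion.1 hy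
      obtain ⟨g'', hm⟩ := Set.mem_iUnion.1 hm
      rcases h x.1 (Set.mem_iUnion.2 ⟨g, hx.1⟩) y.1 (Set.mem_iUnion.2 ⟨g', hy.1⟩)
        m.1 (Set.mem_iUnion.2 ⟨g'', hm.1⟩) hK.1
        (fun h => hφ ⟨h, by rw [hφ₂top]; trivial⟩) with h | h | h
      · exact Or.inl ⟨h, trivial⟩
      · exact Or.inr (Or.inl ⟨h, trivial⟩)
      · refine Or.inr (Or.inr ?_)
        rw [Submodule.mem_colon] at h ⊢
        intro p _
        exact ⟨h p.1 trivial, trivial⟩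
end

section
/- Let g ∈ G and let K be a g-φ-primary R-submodule of M. Suppose x ∈ R_e and m ∈ M_g satisfy xm ∈ φ(K), x ∉ Grad((K :_R M)) and m ∉ K. Then: (1) xK_g ⊆ φ(K); (2) (K :_{R_e} M)m ⊆ φ(K); (3) (K :_{R_e} M)K_g ⊆ φ(K). -/
namespace Gr

variable {G R M : Type*} [Group G] [DecidableEq G] [CommRing R] [AddCommGroup M] [Module R M]

/-- `K` is a `g`-`φ`-primary submodule (for `φ K = φK`): a graded submodule with `K_g ≠ M_g`
such that whenever `r ∈ R_e` and `m ∈ M_g` with `r • m ∈ K - φK`, then `m ∈ K` or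
`r ∈ Grad((K :_R M))`. -/
def IsGPhiPrimaryAt (𝒜 : G → AddSubgroup R) [DirectSum.Decomposition 𝒜]
    (ℳ : G → AddSubgroup M) (g : G) (φK : Set M) (K : Submodule R M) : Prop :=
  IsGradedSubmodule (⋃ g', (ℳ g' : Set M)) K ∧
    (K : Set M) ∩ (ℳ g : Set M) ≠ (ℳ g : Set M) ∧
    ∀ r ∈ 𝒜 1, ∀ m ∈ ℳ g, r • m ∈ K → r • m ∉ φK →
      m ∈ K ∨ r ∈ gradIdealRadical 𝒜 (K.colon ⊤)

/-- `K` is a `g`-`φ`-2-absorbing submodule (for `φ K = φK`): a graded submodule with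
`K_g ≠ M_g` such that whenever `x, y ∈ R_e` and `m ∈ M_g` with `x • y • m ∈ K - φK`, then
`x • m ∈ K` or `y • m ∈ K` or `x * y ∈ (K :_R M)`. -/
def IsGPhiTwoAbsorbingAt (𝒜 : G → AddSubgroup R) (ℳ : G → AddSubgroup M) (g : G)
    (φK : Set M) (K : Submodule R M) : Prop :=
  IsGradedSubmodule (⋃ g', (ℳ g' : Set M)) K ∧
    (K : Set M) ∩ (ℳ g : Set M) ≠ (ℳ g : Set M) ∧
    ∀ x ∈ 𝒜 1, ∀ y ∈ 𝒜 1, ∀ m ∈ ℳ g, x • y • m ∈ K → x • y • m ∉ φK →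
      x • m ∈ K ∨ y • m ∈ K ∨ x * y ∈ K.colon ⊤

/-- `K` is a `g`-`φ`-2-absorbing primary submodule (for `φ K = φK`): a graded submodule with
`K_g ≠ M_g` such that whenever `x, y ∈ R_e` and `m ∈ M_g` with `x • y • m ∈ K - φK`, then
`x • m ∈ Grad_M(K)` or `y • m ∈ Grad_M(K)` or `x * y ∈ (K :_R M)`. -/
def IsGPhiTwoAbsorbingPrimaryAt (𝒜 : G → AddSubgroup R) (ℳ : G → AddSubgroup M) (g : G)
    (φK : Set M) (K : Submodule R M) : Prop :=
  IsGradedSubmodule (⋃ g', (ℳ g' : Set M)) K ∧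
    (K : Set M) ∩ (ℳ g : Set M) ≠ (ℳ g : Set M) ∧
    ∀ x ∈ 𝒜 1, ∀ y ∈ 𝒜 1, ∀ m ∈ ℳ g, x • y • m ∈ K → x • y • m ∉ φK →
      x • m ∈ gradedRadical (⋃ g', (𝒜 g' : Set R)) (⋃ g', (ℳ g' : Set M)) K ∨
      y • m ∈ gradedRadical (⋃ g', (𝒜 g' : Set R)) (⋃ g', (ℳ g' : Set M)) K ∨
      x * y ∈ K.colon ⊤

end Gr

/-- Let `g ∈ G` and `K` be a `g`-`φ`-primary submodule of `M`. Suppose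
`x ∈ R_e` and `m ∈ M_g` satisfy `x • m ∈ φ(K)`, `x ∉ Grad((K :_R M))` and `m ∉ K`. Then
(1) `x • K_g ⊆ φ(K)`; (2) `(K :_{R_e} M) • m ⊆ φ(K)`; (3) `(K :_{R_e} M) • K_g ⊆ φ(K)`. -/
theorem gPhiPrimary_smul_subsets
    {G : Type*} [Group G] [DecidableEq G]
    {R : Type*} [CommRing R] [Nontrivial R]
    {M : Type*} [AddCommGroup M] [Module R M]
    (𝒜 : G → AddSubgroup R) (ℳ : G → AddSubgroup M)
    [DirectSum.Decomposition 𝒜] [DirectSum.Decomposition ℳ]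
    (hone : (1 : R) ∈ 𝒜 1)
    (hmul : ∀ {g h : G} {a b : R}, a ∈ 𝒜 g → b ∈ 𝒜 h → a * b ∈ 𝒜 (g * h))
    (hsmul : ∀ {g h : G} {a : R} {m : M}, a ∈ 𝒜 g → m ∈ ℳ h → a • m ∈ ℳ (g * h))
    (φ : Submodule R M → Set M)
    (hφsub : ∀ N : Submodule R M, Gr.IsGradedSubmodule (⋃ g, (ℳ g : Set M)) N → φ N ⊆ N)
    (hφgr : ∀ N : Submodule R M, Gr.IsGradedSubmodule (⋃ g, (ℳ g : Set M)) N →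
      φ N = ∅ ∨ ∃ P : Submodule R M, Gr.IsGradedSubmodule (⋃ g, (ℳ g : Set M)) P ∧ φ N = ↑P)
    (K : Submodule R M) (g : G)
    (hK : Gr.IsGPhiPrimaryAt 𝒜 ℳ g (φ K) K)
    (x : R) (hx : x ∈ 𝒜 1) (m : M) (hm : m ∈ ℳ g)
    (hxm : x • m ∈ φ K)
    (hxrad : x ∉ Gr.gradIdealRadical 𝒜 (K.colon ⊤))
    (hmK : m ∉ K) :
    (∀ k ∈ K, k ∈ ℳ g → x • k ∈ φ K) ∧
      (∀ r ∈ K.colon ⊤, r ∈ 𝒜 1 → r • m ∈ φ K) ∧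
      (∀ r ∈ K.colon ⊤, r ∈ 𝒜 1 → ∀ k ∈ K, k ∈ ℳ g → r • k ∈ φ K) := by
  obtain ⟨hgr, -, hprim⟩ := hK
  obtain h0 | ⟨P, -, hP⟩ := hφgr K hgr
  · rw [h0] at hxm
    exact hxm.elim
  have hsub := hφsub K hgr
  rw [hP] at hxm hprim hsub ⊢
  have hxmK : x • m ∈ K := hsub hxm
  -- `x + r` is not in the graded radical
  have hrad : ∀ r ∈ K.colon ⊤, r ∈ 𝒜 1 → x + r ∉ Gr.gradIdealRadical 𝒜 (K.colon ⊤) := by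
    intro r hr hr1 hxr
    apply hxrad
    intro h
    by_cases hh : 1 = h
    · subst hh
      obtain ⟨n, hn, hmem⟩ := hxr 1
      refine ⟨n, hn, ?_⟩
      rw [DirectSum.decompose_of_mem_same 𝒜 ((𝒜 1).add_mem hx hr1)] at hmem
      rw [DirectSum.decompose_of_mem_same 𝒜 hx]
      have hd : r ∣ (x + r) ^ n - x ^ n := by
        have := sub_dvd_pow_sub_pow (x + r) x n
        rwa [add_sub_cancel_left] at this
      have h2 := Ideal.mem_of_dvd _ hd hr
      have h3 := Ideal.sub_mem _ hmem h2
      rwa [sub_sub_cancel] at h3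
    · refine ⟨1, one_pos, ?_⟩
      rw [DirectSum.decompose_of_mem_ne 𝒜 hx hh, pow_one]
      exact Ideal.zero_mem _
  have key : ∀ r ∈ K.colon ⊤, r ∈ 𝒜 1 → ∀ k ∈ K, k ∈ ℳ g → (x + r) • (m + k) ∈ P := by
    intro r hr hr1 k hk hkg
    by_contra hcon
    have hin : (x + r) • (m + k) ∈ K := by
      rw [smul_add, add_smul]
      exact K.add_mem (K.add_mem hxmK (Submodule.mem_colon.1 hr m trivial)) (K.smul_mem _ hk)
    rcases hprim (x + r) ((𝒜 1).add_mem hx hr1) (m + k) ((ℳ g).add_mem hm hkg) hin hcon with h | h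
    · exact hmK ((K.add_mem_iff_left hk).1 h)
    · exact hrad r hr hr1 h
  have h1 : ∀ k ∈ K, k ∈ ℳ g → x • k ∈ P := by
    intro k hk hkg
    have := key 0 (Ideal.zero_mem _) (𝒜 1).zero_mem k hk hkg
    rw [add_zero, smul_add] at this
    exact (P.add_mem_iff_right hxm).1 this
  have h2 : ∀ r ∈ K.colon ⊤, r ∈ 𝒜 1 → r • m ∈ P := by
    intro r hr hr1
    have := key r hr hr1 0 K.zero_mem (ℳ g).zero_mem
    rw [add_zero, add_smul] at this
    exact (P.add_mem_iff_right hxm).1 this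
  refine ⟨h1, h2, ?_⟩
  intro r hr hr1 k hk hkg
  have := key r hr hr1 k hk hkg
  rw [smul_add, add_smul, add_smul] at this
  have h3 := (P.add_mem_iff_right (P.add_mem hxm (h2 r hr hr1))).1 this
  exact (P.add_mem_iff_right (h1 k hk hkg)).1 h3
end

section
/- Let g ∈ G and let K be a g-φ-2-absorbing R-submodule of M. Suppose x, y ∈ R_e and m ∈ M_g satisfy xym ∈ φ(K), xy ∉ (K :_R M), xm ∉ K and ym ∉ K. Then: (1) xyK_g ⊆ φ(K); (2) x(K :_{R_e} M)m ⊆ φ(K); (3) y(K :_{R_e} M)m ⊆ φ(K); (4) (K :_{R_e} M)²m ⊆ φ(K). -/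
/-- Let `g ∈ G` and `K` be a `g`-`φ`-2-absorbing submodule of `M`. Suppose
`x, y ∈ R_e` and `m ∈ M_g` satisfy `x • y • m ∈ φ(K)`, `x * y ∉ (K :_R M)`, `x • m ∉ K` and
`y • m ∉ K`. Then (1) `x * y • K_g ⊆ φ(K)`; (2) `x • (K :_{R_e} M) • m ⊆ φ(K)`;
(3) `y • (K :_{R_e} M) • m ⊆ φ(K)`; (4) `(K :_{R_e} M)² • m ⊆ φ(K)`. -/
theorem gPhiTwoAbsorbing_smul_subsets
    {G : Type*} [Group G] [DecidableEq G]
    {R : Type*} [CommRing R] [Nontrivial R]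
    {M : Type*} [AddCommGroup M] [Module R M]
    (𝒜 : G → AddSubgroup R) (ℳ : G → AddSubgroup M)
    [DirectSum.Decomposition 𝒜] [DirectSum.Decomposition ℳ]
    (hone : (1 : R) ∈ 𝒜 1)
    (hmul : ∀ {g h : G} {a b : R}, a ∈ 𝒜 g → b ∈ 𝒜 h → a * b ∈ 𝒜 (g * h))
    (hsmul : ∀ {g h : G} {a : R} {m : M}, a ∈ 𝒜 g → m ∈ ℳ h → a • m ∈ ℳ (g * h))
    (φ : Submodule R M → Set M)
    (hφsub : ∀ N : Submodule R M, Gr.IsGradedSubmodule (⋃ g, (ℳ g : Set M)) N → φ N ⊆ N)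
    (hφgr : ∀ N : Submodule R M, Gr.IsGradedSubmodule (⋃ g, (ℳ g : Set M)) N →
      φ N = ∅ ∨ ∃ P : Submodule R M, Gr.IsGradedSubmodule (⋃ g, (ℳ g : Set M)) P ∧ φ N = ↑P)
    (K : Submodule R M) (g : G)
    (hK : Gr.IsGPhiTwoAbsorbingAt 𝒜 ℳ g (φ K) K)
    (x : R) (hx : x ∈ 𝒜 1) (y : R) (hy : y ∈ 𝒜 1) (m : M) (hm : m ∈ ℳ g)
    (hxym : x • y • m ∈ φ K)
    (hxy : x * y ∉ K.colon ⊤)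
    (hxm : x • m ∉ K) (hym : y • m ∉ K) :
    (∀ k ∈ K, k ∈ ℳ g → (x * y) • k ∈ φ K) ∧
      (∀ a ∈ K.colon ⊤, a ∈ 𝒜 1 → (x * a) • m ∈ φ K) ∧
      (∀ a ∈ K.colon ⊤, a ∈ 𝒜 1 → (y * a) • m ∈ φ K) ∧
      (∀ a ∈ K.colon ⊤, a ∈ 𝒜 1 → ∀ b ∈ K.colon ⊤, b ∈ 𝒜 1 → (a * b) • m ∈ φ K) := by
  obtain ⟨hgr, -, habs⟩ := hK
  obtain ⟨P, hP⟩ : ∃ P : Submodule R M, φ K = ↑P := by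
    rcases hφgr K hgr with h | ⟨P, -, h⟩
    · rw [h] at hxym
      exact absurd hxym (Set.notMem_empty _)
    · exact ⟨P, h⟩
  have hsub := hφsub K hgr
  rw [hP] at hxym habs hsub ⊢
  simp only [SetLike.mem_coe] at hxym habs ⊢
  have hc : ∀ a ∈ K.colon (⊤ : Set M), ∀ n : M, a • n ∈ K := fun a ha n =>
    Submodule.mem_colon.1 ha n trivial
  have key : ∀ a ∈ K.colon (⊤ : Set M), a ∈ 𝒜 1 → ∀ b ∈ K.colon (⊤ : Set M), b ∈ 𝒜 1 →
      ∀ k ∈ K, k ∈ ℳ g → (x + a) • (y + b) • (m + k) ∈ P := by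
    intro a ha ha1 b hb hb1 k hk hk1
    by_contra hn
    have hKm : (x + a) • (y + b) • (m + k) ∈ K := by
      have e : (x + a) • (y + b) • (m + k) =
          x • y • m + (x • y • k + x • b • (m + k) + a • (y + b) • (m + k)) := by module
      rw [e]
      exact K.add_mem (hsub hxym) (K.add_mem (K.add_mem
        (K.smul_mem _ (K.smul_mem _ hk)) (K.smul_mem _ (hc b hb _))) (hc a ha _))
    rcases habs (x + a) (add_mem hx ha1) (y + b) (add_mem hy hb1) (m + k) (add_mem hm hk1)
      hKm hn with h | h | h
    · apply hxm
      have e : x • m = (x + a) • (m + k) - (x • k + a • (m + k)) := by module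
      rw [e]
      exact K.sub_mem h (K.add_mem (K.smul_mem _ hk) (hc a ha _))
    · apply hym
      have e : y • m = (y + b) • (m + k) - (y • k + b • (m + k)) := by module
      rw [e]
      exact K.sub_mem h (K.add_mem (K.smul_mem _ hk) (hc b hb _))
    · apply hxy
      have e : x * y = (x + a) * (y + b) - (x * b + (y + b) * a) := by ring
      rw [e]
      exact Ideal.sub_mem _ h (Ideal.add_mem _ (Ideal.mul_mem_left _ _ hb)
        (Ideal.mul_mem_left _ _ ha))
  have z := (K.colon (⊤ : Set M)).zero_mem
  have z1 := (𝒜 1).zero_mem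
  have zk := K.zero_mem
  have zg := (ℳ g).zero_mem
  have h2 : ∀ a ∈ K.colon (⊤ : Set M), a ∈ 𝒜 1 → (x * a) • m ∈ P := by
    intro a ha ha1
    have := P.sub_mem (key 0 z z1 a ha ha1 0 zk zg) hxym
    convert this using 1
    module
  have h3 : ∀ a ∈ K.colon (⊤ : Set M), a ∈ 𝒜 1 → (y * a) • m ∈ P := by
    intro a ha ha1
    have := P.sub_mem (key a ha ha1 0 z z1 0 zk zg) hxym
    convert this using 1
    module
  refine ⟨?_, h2, h3, ?_⟩
  · intro k hk hk1
    have := P.sub_mem (key 0 z z1 0 z z1 k hk hk1) hxym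
    convert this using 1
    module
  · intro a ha ha1 b hb hb1
    have := P.sub_mem (P.sub_mem (P.sub_mem (key a ha ha1 b hb hb1 0 zk zg) hxym)
      (h2 b hb hb1)) (h3 a ha ha1)
    convert this using 1
    module
end

section
/- Let g ∈ G and let K be a g-φ-2-absorbing primary R-submodule of M that is not a g-2-absorbing primary R-submodule of M. Then (K :_{R_e} M)²K_g ⊆ φ(K). -/
/-- Let `g ∈ G` and `K` be a `g`-`φ`-2-absorbing primary submodule of `M`
that is not a `g`-2-absorbing primary submodule of `M`. Then
`(K :_{R_e} M)² • K_g ⊆ φ(K)`. -/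
theorem gPhiTwoAbsorbingPrimary_colon_sq_g_component_subset
    {G : Type*} [Group G] [DecidableEq G]
    {R : Type*} [CommRing R] [Nontrivial R]
    {M : Type*} [AddCommGroup M] [Module R M]
    (𝒜 : G → AddSubgroup R) (ℳ : G → AddSubgroup M)
    [DirectSum.Decomposition 𝒜] [DirectSum.Decomposition ℳ]
    (hone : (1 : R) ∈ 𝒜 1)
    (hmul : ∀ {g h : G} {a b : R}, a ∈ 𝒜 g → b ∈ 𝒜 h → a * b ∈ 𝒜 (g * h))
    (hsmul : ∀ {g h : G} {a : R} {m : M}, a ∈ 𝒜 g → m ∈ ℳ h → a • m ∈ ℳ (g * h))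
    (φ : Submodule R M → Set M)
    (hφsub : ∀ N : Submodule R M, Gr.IsGradedSubmodule (⋃ g, (ℳ g : Set M)) N → φ N ⊆ N)
    (hφgr : ∀ N : Submodule R M, Gr.IsGradedSubmodule (⋃ g, (ℳ g : Set M)) N →
      φ N = ∅ ∨ ∃ P : Submodule R M, Gr.IsGradedSubmodule (⋃ g, (ℳ g : Set M)) P ∧ φ N = ↑P)
    (K : Submodule R M) (g : G)
    (hK : Gr.IsGPhiTwoAbsorbingPrimaryAt 𝒜 ℳ g (φ K) K)
    (hnot : ¬ Gr.IsGPhiTwoAbsorbingPrimaryAt 𝒜 ℳ g (∅ : Set M) K) :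
    ∀ a ∈ K.colon ⊤, a ∈ 𝒜 1 → ∀ b ∈ K.colon ⊤, b ∈ 𝒜 1 →
      ∀ k ∈ K, k ∈ ℳ g → (a * b) • k ∈ φ K := by
  classical
  obtain ⟨hgr, hne, hab⟩ := hK
  have hex : ∃ x ∈ 𝒜 1, ∃ y ∈ 𝒜 1, ∃ m ∈ ℳ g, x • y • m ∈ K ∧
      x • m ∉ Gr.gradedRadical (⋃ g', (𝒜 g' : Set R)) (⋃ g', (ℳ g' : Set M)) K ∧
      y • m ∉ Gr.gradedRadical (⋃ g', (𝒜 g' : Set R)) (⋃ g', (ℳ g' : Set M)) K ∧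
      x * y ∉ K.colon ⊤ := by
    by_contra hcon
    apply hnot
    refine ⟨hgr, hne, ?_⟩
    intro x hx y hy m hm hxy _
    by_contra h
    push Not at h
    exact hcon ⟨x, hx, y, hy, m, hm, hxy, h.1, h.2.1, h.2.2⟩
  obtain ⟨x, hx, y, hy, m, hm, hxym, h1, h2, h3⟩ := hex
  have hKG : K ≤ Gr.gradedRadical (⋃ g', (𝒜 g' : Set R)) (⋃ g', (ℳ g' : Set M)) K :=
    le_sInf fun P hP => hP.2
  have hc : ∀ a ∈ K.colon ⊤, ∀ n : M, a • n ∈ K := fun a ha n =>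
    Submodule.mem_colon.1 ha n trivial
  have key : ∀ a ∈ K.colon ⊤, a ∈ 𝒜 1 → ∀ b ∈ K.colon ⊤, b ∈ 𝒜 1 →
      ∀ k ∈ K, k ∈ ℳ g → (x + a) • (y + b) • (m + k) ∈ φ K := by
    intro a ha ha1 b hb hb1 k hk hk1
    by_contra hn
    have hmem : (x + a) • (y + b) • (m + k) ∈ K := by
      have e : (x + a) • (y + b) • (m + k)
          = x • y • m + ((x * y) • k + (x • (b • (m + k)) + a • ((y + b) • (m + k)))) := by
        module
      rw [e]
      exact K.add_mem hxym (K.add_mem (K.smul_mem _ hk)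
        (K.add_mem (K.smul_mem _ (hc b hb _)) (hc a ha _)))
    have aux : ∀ z c : R, c ∈ K.colon ⊤ →
        (z + c) • (m + k) ∈ Gr.gradedRadical (⋃ g', (𝒜 g' : Set R)) (⋃ g', (ℳ g' : Set M)) K →
        z • m ∈ Gr.gradedRadical (⋃ g', (𝒜 g' : Set R)) (⋃ g', (ℳ g' : Set M)) K := by
      intro z c hcc hz
      have e : z • m = (z + c) • (m + k) - (z • k + c • (m + k)) := by module
      rw [e]
      exact Submodule.sub_mem _ hz (hKG (K.add_mem (K.smul_mem _ hk) (hc c hcc _)))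
    rcases hab (x + a) (add_mem hx ha1) (y + b) (add_mem hy hb1) (m + k) (add_mem hm hk1)
      hmem hn with h | h | h
    · exact h1 (aux x a ha h)
    · exact h2 (aux y b hb h)
    · apply h3
      have e : x * y = (x + a) * (y + b) - (x * b + (y + b) * a) := by ring
      rw [e]
      exact Ideal.sub_mem _ h (Ideal.add_mem _ (Ideal.mul_mem_left _ _ hb)
        (Ideal.mul_mem_left _ _ ha))
  intro a ha ha1 b hb hb1 k hk hk1
  have z1 := zero_mem (K.colon (⊤ : Set M))
  have z2 := zero_mem (𝒜 1)
  have z3 := zero_mem K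
  have z4 := zero_mem (ℳ g)
  have f111 := key a ha ha1 b hb hb1 k hk hk1
  have f110 := key a ha ha1 b hb hb1 0 z3 z4
  have f101 := key a ha ha1 0 z1 z2 k hk hk1
  have f100 := key a ha ha1 0 z1 z2 0 z3 z4
  have f011 := key 0 z1 z2 b hb hb1 k hk hk1
  have f010 := key 0 z1 z2 b hb hb1 0 z3 z4
  have f001 := key 0 z1 z2 0 z1 z2 k hk hk1
  have f000 := key 0 z1 z2 0 z1 z2 0 z3 z4
  rcases hφgr K hgr with h | ⟨P, -, h⟩
  · rw [h] at f000
    exact f000.elim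
  · rw [h] at f111 f110 f101 f100 f011 f010 f001 f000 ⊢
    have e : (a * b) • k =
        ((x + a) • (y + b) • (m + k) - (x + a) • (y + b) • (m + 0))
        - ((x + a) • (y + 0) • (m + k) - (x + a) • (y + 0) • (m + 0))
        - (((x + 0) • (y + b) • (m + k) - (x + 0) • (y + b) • (m + 0))
        - ((x + 0) • (y + 0) • (m + k) - (x + 0) • (y + 0) • (m + 0))) := by
      module
    rw [e]
    exact P.sub_mem (P.sub_mem (P.sub_mem f111 f110) (P.sub_mem f101 f100))
      (P.sub_mem (P.sub_mem f011 f010) (P.sub_mem f001 f000))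
end
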